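/- arXiv:2304.07812 — 5 statements merged into one kernel-verified Lean document; each statement's English description precedes it below -/
import Mathlib

section
/- Let 0 < α < 1 and T > 0. Suppose y : [0,T] → ℝ is continuous on [0,T], differentiable on (0,T], and the function t ↦ t^{1-α} y'(t) extends continuously to [0,T]. If y attains its minimum over [0,T] at a point t₀ ∈ (0,T], then the pointwise Caputo fractional derivative of y at t₀ is nonpositive: (1/Γ(1-α)) ∫_0^{t₀} (t₀ - s)^{-α} y'(s) ds ≤ 0. -/
open MeasureTheory intervalIntegral Set

/-- The difference `y s - y t₀`, weighted by the singular kernel `(t₀ - s) ^ (-α)`, is continuous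
up to `t₀`, because it equals `-(t₀ - s) ^ (1 - α)` times the difference quotient of `y`. -/
lemma continuousOn_rpow_neg_mul_sub {α t₀ : ℝ} (hα1 : α < 1) {y : ℝ → ℝ}
    (hy_cont : ContinuousOn y (Icc 0 t₀)) (hy_diff : DifferentiableAt ℝ y t₀) :
    ContinuousOn (fun s => (t₀ - s) ^ (-α) * (y s - y t₀)) (Icc 0 t₀) := by
  have hcont : ContinuousOn (fun s => -((t₀ - s) ^ (1 - α) * dslope y t₀ s)) (Icc 0 t₀) := by
    refine (ContinuousOn.mul ?_ fun s hs => ?_).neg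
    · exact (continuousOn_const.sub continuousOn_id).rpow_const
        fun s _ => Or.inr (sub_pos.2 hα1).le
    · rcases eq_or_ne s t₀ with rfl | hne
      · exact (continuousAt_dslope_same.2 hy_diff).continuousWithinAt
      · exact (continuousWithinAt_dslope_of_ne hne).2 (hy_cont s hs)
  refine hcont.congr fun s hs => ?_
  rcases hs.2.eq_or_lt with rfl | hlt
  · simp [Real.zero_rpow (sub_pos.2 hα1).ne']
  · have hpos : 0 < t₀ - s := sub_pos.2 hlt
    have hslope : (s - t₀) * dslope y t₀ s = y s - y t₀ := by
      simpa using sub_smul_dslope y t₀ s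
    simp only
    rw [← hslope, show 1 - α = -α + 1 by ring, Real.rpow_add_one hpos.ne']
    ring

/-- Extremum principle for the pointwise Caputo fractional derivative:
if `y` attains its minimum over `[0,T]` at `t₀ ∈ (0,T]`, then the Caputo
derivative of `y` at `t₀` is nonpositive. -/
theorem caputo_extremum_principle
    (α T : ℝ) (hα0 : 0 < α) (hα1 : α < 1) (hT : 0 < T)
    (y y' : ℝ → ℝ)
    (hy_cont : ContinuousOn y (Set.Icc 0 T))
    (hy_deriv : ∀ t ∈ Set.Ioc 0 T, HasDerivAt y (y' t) t)
    (hy_ext : ∃ g : ℝ → ℝ, ContinuousOn g (Set.Icc 0 T) ∧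
      ∀ t ∈ Set.Ioc 0 T, g t = t ^ (1 - α) * y' t)
    (t₀ : ℝ) (ht₀ : t₀ ∈ Set.Ioc 0 T)
    (hmin : ∀ t ∈ Set.Icc 0 T, y t₀ ≤ y t) :
    (1 / Real.Gamma (1 - α)) * ∫ s in (0:ℝ)..t₀, (t₀ - s) ^ (-α) * y' s ≤ 0 := by
  have hΓ : 0 < Real.Gamma (1 - α) := Real.Gamma_pos_of_pos (sub_pos.2 hα1)
  refine mul_nonpos_of_nonneg_of_nonpos (one_div_pos.2 hΓ).le ?_
  by_cases hint : IntervalIntegrable (fun s => (t₀ - s) ^ (-α) * y' s) volume 0 t₀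
  swap
  · exact (intervalIntegral.integral_undef hint).le
  have hle := integral_le_sub_of_hasDeriv_right_of_le
    (g' := fun s => -1 * -α * (t₀ - s) ^ (-α - 1) * (y s - y t₀) + (t₀ - s) ^ (-α) * y' s)
    ht₀.1.le
    (continuousOn_rpow_neg_mul_sub hα1 (hy_cont.mono (Icc_subset_Icc_right ht₀.2))
      (hy_deriv t₀ ht₀).differentiableAt)
    (fun s hs => ?_) ((intervalIntegrable_iff_integrableOn_Icc_of_le ht₀.1.le).1 hint)
    (fun s hs => ?_)
  · have hF0 : 0 ≤ (t₀ - 0) ^ (-α) * (y 0 - y t₀) :=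
      mul_nonneg (Real.rpow_nonneg (by simpa using ht₀.1.le) _)
        (sub_nonneg.2 (hmin 0 (left_mem_Icc.2 hT.le)))
    simp only [sub_self, mul_zero] at hle
    linarith
  · have hbase : HasDerivAt (fun s => t₀ - s) (-1) s := (hasDerivAt_id s).const_sub t₀
    exact ((hbase.rpow_const (Or.inl (sub_pos.2 hs.2).ne')).mul
      ((hy_deriv s ⟨hs.1, hs.2.le.trans ht₀.2⟩).sub_const (y t₀))).hasDerivWithinAt
  · have hpow : 0 ≤ (t₀ - s) ^ (-α - 1) := Real.rpow_nonneg (sub_pos.2 hs.2).le _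
    have hy : 0 ≤ y s - y t₀ := sub_nonneg.2 (hmin s ⟨hs.1.le, hs.2.le.trans ht₀.2⟩)
    have hnonneg : 0 ≤ α * (t₀ - s) ^ (-α - 1) * (y s - y t₀) := by positivity
    linarith
end

section
/- For every α ∈ (0,1), λ > 0 and t > 0, the function g(t) = E_{α,1}(-λ t^α) is differentiable at t and its derivative equals g'(t) = -λ t^{α-1} E_{α,α}(-λ t^α). -/
open Real

/-- The Mittag-Leffler function `E_{α,β}(z) = ∑_{k=0}^∞ z^k / Γ(α k + β)`. -/
noncomputable def mittagLeffler (α β z : ℝ) : ℝ :=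
  ∑' k : ℕ, z ^ k / Real.Gamma (α * k + β)

/-- An exponential lower bound for the Gamma function with arbitrary base `R ≥ 0`. -/
theorem rpow_mul_exp_neg_le_Gamma {R x : ℝ} (hR : 0 ≤ R) (hx : 1 ≤ x) :
    R ^ (x - 1) * Real.exp (-R) ≤ Real.Gamma x := by
  have hint := Real.GammaIntegral_convergent (zero_lt_one.trans_le hx)
  have hsub : Set.Ioi R ⊆ Set.Ioi 0 := Set.Ioi_subset_Ioi hR
  rw [Real.Gamma_eq_integral (zero_lt_one.trans_le hx), ← integral_exp_neg_Ioi R,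
    ← MeasureTheory.integral_const_mul]
  calc ∫ u in Set.Ioi R, R ^ (x - 1) * Real.exp (-u)
      ≤ ∫ u in Set.Ioi R, Real.exp (-u) * u ^ (x - 1) := by
        refine MeasureTheory.setIntegral_mono_on ((integrableOn_exp_neg_Ioi R).const_mul _)
          (hint.mono_set hsub) measurableSet_Ioi fun u hu => ?_
        rw [mul_comm]
        gcongr
        exact le_of_lt hu
    _ ≤ ∫ u in Set.Ioi 0, Real.exp (-u) * u ^ (x - 1) := by
        refine MeasureTheory.setIntegral_mono_set hint ?_ hsub.eventuallyLE
        filter_upwards [MeasureTheory.ae_restrict_mem measurableSet_Ioi] with u hu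
        have : (0 : ℝ) < u := hu
        simp only [Pi.zero_apply]
        positivity

/-- The termwise derivatives of the series of `E_{α,1}` are uniformly summable on balls. -/
theorem exists_summable_bound_deriv_mittagLeffler {α r : ℝ} (hα : 0 < α) (hr : 1 ≤ r) :
    ∃ u : ℕ → ℝ, Summable u ∧ ∀ (k : ℕ) (y : ℝ), y ∈ Metric.ball (0 : ℝ) r →
      ‖k * y ^ (k - 1) / Real.Gamma (α * k + 1)‖ ≤ u k := by
  obtain ⟨R, hR, hRα⟩ : ∃ R : ℝ, 0 < R ∧ R ^ α = 2 * r :=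
    ⟨(2 * r) ^ α⁻¹, by positivity, Real.rpow_inv_rpow (by positivity) hα.ne'⟩
  have hGamma (k : ℕ) : (2 * r) ^ k * Real.exp (-R) ≤ Real.Gamma (α * k + 1) := by
    have h := rpow_mul_exp_neg_le_Gamma hR.le (x := α * k + 1)
      (by linarith [mul_nonneg hα.le (Nat.cast_nonneg (α := ℝ) k)])
    rwa [add_sub_cancel_right, Real.rpow_mul hR.le, hRα, Real.rpow_natCast] at h
  have hhalf : ‖(1 / 2 : ℝ)‖ < 1 := by norm_num
  have hsum : Summable fun k : ℕ => (k : ℝ) ^ 1 * (1 / 2 : ℝ) ^ k :=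
    summable_pow_mul_geometric_of_norm_lt_one 1 hhalf
  refine ⟨fun k => Real.exp R * ((k : ℝ) ^ 1 * (1 / 2 : ℝ) ^ k), hsum.mul_left _,
    fun k y hy => ?_⟩
  have hyr : |y| ≤ r := by simpa using (Metric.mem_ball.1 hy).le
  have hpow : |y| ^ (k - 1) ≤ r ^ k :=
    (pow_le_pow_left₀ (abs_nonneg y) hyr _).trans (pow_le_pow_right₀ hr (Nat.sub_le k 1))
  have hpos : 0 < (2 * r) ^ k * Real.exp (-R) := by positivity
  rw [norm_div, norm_mul, norm_pow, Real.norm_natCast, Real.norm_eq_abs, Real.norm_eq_abs,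
    abs_of_pos (hpos.trans_le (hGamma k))]
  calc k * |y| ^ (k - 1) / Real.Gamma (α * k + 1)
      ≤ k * r ^ k / ((2 * r) ^ k * Real.exp (-R)) := by
        gcongr
        exact hGamma k
    _ = Real.exp R * ((k : ℝ) ^ 1 * (1 / 2 : ℝ) ^ k) := by
        rw [Real.exp_neg, mul_pow, one_div, inv_pow]
        field_simp

/-- The derivative of `E_{α,1}` is `E_{α,α} / α`. -/
theorem hasDerivAt_mittagLeffler_one {α : ℝ} (hα : 0 < α) (z : ℝ) :
    HasDerivAt (mittagLeffler α 1) (mittagLeffler α α z / α) z := by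
  obtain ⟨r, hr1, hzr⟩ : ∃ r : ℝ, 1 ≤ r ∧ |z| < r :=
    ⟨|z| + 1, by linarith [abs_nonneg z], by linarith⟩
  obtain ⟨u, hu, hbound⟩ := exists_summable_bound_deriv_mittagLeffler hα hr1
  have hzmem : z ∈ Metric.ball (0 : ℝ) r := by simpa using hzr
  have hderiv := hasDerivAt_tsum_of_isPreconnected hu Metric.isOpen_ball
    (convex_ball (0 : ℝ) r).isPreconnected
    (g := fun (k : ℕ) y => y ^ k / Real.Gamma (α * k + 1))
    (g' := fun (k : ℕ) y => k * y ^ (k - 1) / Real.Gamma (α * k + 1))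
    (fun k y _ => (hasDerivAt_pow k y).div_const _) hbound
    (y₀ := 0) (Metric.mem_ball_self (by positivity))
    (summable_of_ne_finset_zero (s := {0}) fun k hk => by
      rw [zero_pow (by simpa using hk), zero_div]) hzmem
  have hsum : Summable fun k : ℕ => k * z ^ (k - 1) / Real.Gamma (α * k + 1) :=
    Summable.of_norm_bounded hu fun k => hbound k z hzmem
  refine HasDerivAt.congr_deriv (f := mittagLeffler α 1) hderiv (Eq.symm ?_)
  rw [hsum.tsum_eq_zero_add, mittagLeffler, ← tsum_div_const]
  simp only [Nat.cast_zero, zero_mul, zero_div, zero_add]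
  refine tsum_congr fun k => ?_
  have hk : 0 < α * k + α := by positivity
  have hG := (Real.Gamma_pos_of_pos hk).ne'
  rw [Nat.add_sub_cancel, Nat.cast_add_one, mul_add_one, Real.Gamma_add_one hk.ne']
  field_simp

/-- For `α ∈ (0,1)`, `λ > 0` and `t > 0`, the function `t ↦ E_{α,1}(-λ t^α)` is
differentiable at `t` with derivative `-λ t^{α-1} E_{α,α}(-λ t^α)`. -/
theorem hasDerivAt_mittagLeffler_neg_rpow
    (α lam t : ℝ) (hα : α ∈ Set.Ioo (0:ℝ) 1) (hlam : 0 < lam) (ht : 0 < t) :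
    HasDerivAt (fun s : ℝ => mittagLeffler α 1 (-lam * s ^ α))
      (-lam * t ^ (α - 1) * mittagLeffler α α (-lam * t ^ α)) t := by
  have ht' : HasDerivAt (fun s : ℝ => -lam * s ^ α) (-lam * (α * t ^ (α - 1))) t :=
    (Real.hasDerivAt_rpow_const (Or.inl ht.ne')).const_mul _
  have hα0 : α ≠ 0 := hα.1.ne'
  refine ((hasDerivAt_mittagLeffler_one hα.1 (-lam * t ^ α)).comp t ht').congr_deriv ?_
  field_simp
end

section
/- Let α ∈ (0,1), λ > 0, T > 0, and let f : [0,T] → ℝ be continuous. Define (Lf)(t) = ∫_0^t (t-s)^{α-1} E_{α,α}(-λ (t-s)^α) f(s) ds. Then λ² ∫_0^T ((Lf)(t))² dt ≤ ∫_0^T (f(t))² dt, i.e. the L²(0,T)-norm of λ·Lf is bounded by the L²(0,T)-norm of f. -/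
open MeasureTheory intervalIntegral

theorem integral_rpow_mul_sub_rpow {a b t : ℝ} (ha : 0 < a) (hb : 0 < b) (ht : 0 < t) :
    ∫ s in (0:ℝ)..t, s ^ (a - 1) * (t - s) ^ (b - 1) =
      t ^ (a + b - 1) * (Real.Gamma a * Real.Gamma b / Real.Gamma (a + b)) := by
  have h := Complex.betaIntegral_scaled a b ht
  rw [Complex.betaIntegral_eq_Gamma_mul_div _ _ (by simpa) (by simpa), ← Complex.ofReal_add,
    Complex.Gamma_ofReal, Complex.Gamma_ofReal, Complex.Gamma_ofReal] at h
  have h2 : ∫ x in (0:ℝ)..t, (x : ℂ) ^ ((a : ℂ) - 1) * ((t : ℂ) - x) ^ ((b : ℂ) - 1) =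
      ∫ x in (0:ℝ)..t, ((x ^ (a - 1) * (t - x) ^ (b - 1) : ℝ) : ℂ) := by
    refine integral_congr fun x hx => ?_
    rw [Set.uIcc_of_le ht.le] at hx
    push_cast
    rw [Complex.ofReal_cpow hx.1, Complex.ofReal_cpow (sub_nonneg.2 hx.2)]
    push_cast
    rfl
  rw [h2, intervalIntegral.integral_ofReal] at h
  have h3 : ((t : ℂ) ^ (((a + b : ℝ) : ℂ) - 1)) = ((t ^ (a + b - 1) : ℝ) : ℂ) := by
    rw [Complex.ofReal_cpow ht.le]; push_cast; rfl
  rw [h3] at h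
  exact_mod_cast h

/-- The Riemann–Liouville kernel `t₊^(a-1) / Γ(a)`, damped by the factor `exp (-c t)`. -/
noncomputable def gammaKernel (c a : ℝ) : ℝ → ℝ :=
  (Set.Ioi 0).indicator fun t => t ^ (a - 1) * Real.exp (-(c * t)) / Real.Gamma a

theorem gammaKernel_of_pos {c a t : ℝ} (ht : 0 < t) :
    gammaKernel c a t = t ^ (a - 1) * Real.exp (-(c * t)) / Real.Gamma a :=
  Set.indicator_of_mem ht _

theorem gammaKernel_of_nonpos {c a t : ℝ} (ht : t ≤ 0) : gammaKernel c a t = 0 :=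
  Set.indicator_of_notMem (by simpa using ht) _

theorem measurable_gammaKernel (c a : ℝ) : Measurable (gammaKernel c a) :=
  Measurable.indicator (by fun_prop) measurableSet_Ioi

theorem gammaKernel_nonneg {c a : ℝ} (ha : 0 < a) (t : ℝ) : 0 ≤ gammaKernel c a t :=
  Set.indicator_nonneg (fun t (ht : 0 < t) => by
    have := Real.Gamma_pos_of_pos ha
    positivity) t

theorem integrable_gammaKernel {c a : ℝ} (hc : 0 < c) (ha : 0 < a) :
    Integrable (gammaKernel c a) := by
  rw [gammaKernel, integrable_indicator_iff measurableSet_Ioi]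
  have h := integrableOn_rpow_mul_exp_neg_mul_rpow (s := a - 1) (p := 1) (b := c)
    (by linarith) one_pos hc
  simpa [IntegrableOn] using h.div_const (Real.Gamma a)

theorem integral_gammaKernel {c a : ℝ} (hc : 0 < c) (ha : 0 < a) :
    ∫ t, gammaKernel c a t = (1 / c) ^ a := by
  have := Real.Gamma_pos_of_pos ha
  rw [gammaKernel, MeasureTheory.integral_indicator measurableSet_Ioi, MeasureTheory.integral_div,
    Real.integral_rpow_mul_exp_neg_mul_Ioi ha hc]
  field_simp

theorem integral_gammaKernel_mul_gammaKernel {c a b : ℝ} (ha : 0 < a) (hb : 0 < b) (t : ℝ) :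
    ∫ s, gammaKernel c a s * gammaKernel c b (t - s) = gammaKernel c (a + b) t := by
  rcases le_or_gt t 0 with ht | ht
  · rw [gammaKernel_of_nonpos ht]
    refine integral_eq_zero_of_ae (.of_forall fun s => ?_)
    rcases le_or_gt s 0 with hs | hs
    · simp [gammaKernel_of_nonpos hs]
    · simp [gammaKernel_of_nonpos (show t - s ≤ 0 by linarith)]
  · have hΓa := Real.Gamma_pos_of_pos ha
    have hΓb := Real.Gamma_pos_of_pos hb
    have hΓ := Real.Gamma_pos_of_pos (add_pos ha hb)
    have h : (fun s => gammaKernel c a s * gammaKernel c b (t - s)) =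
        (Set.Ioo 0 t).indicator fun s => s ^ (a - 1) * (t - s) ^ (b - 1) *
          (Real.exp (-(c * t)) / (Real.Gamma a * Real.Gamma b)) := by
      funext s
      by_cases hs : s ∈ Set.Ioo 0 t
      · rw [Set.indicator_of_mem hs, gammaKernel_of_pos hs.1, gammaKernel_of_pos (sub_pos.2 hs.2)]
        have : Real.exp (-(c * t)) = Real.exp (-(c * s)) * Real.exp (-(c * (t - s))) := by
          rw [← Real.exp_add]; congr 1; ring
        rw [this]
        field_simp
      · rw [Set.indicator_of_notMem hs]
        rcases le_or_gt s 0 with hs0 | hs0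
        · simp [gammaKernel_of_nonpos hs0]
        · have : t - s ≤ 0 := by
            by_contra! h
            exact hs ⟨hs0, by linarith⟩
          simp [gammaKernel_of_nonpos this]
    rw [h, MeasureTheory.integral_indicator measurableSet_Ioo, ← integral_Ioc_eq_integral_Ioo,
      ← integral_of_le ht.le, intervalIntegral.integral_mul_const,
      integral_rpow_mul_sub_rpow ha hb ht, gammaKernel_of_pos ht]
    field_simp

theorem ae_summable_norm_of_summable_integral_norm {X : Type*} [MeasurableSpace X]
    {μ : Measure X} {F : ℕ → X → ℝ} (hF : ∀ n, Integrable (F n) μ)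
    (hs : Summable fun n => ∫ x, ‖F n x‖ ∂μ) : ∀ᵐ x ∂μ, Summable fun n => ‖F n x‖ := by
  refine summable_norm_of_tsum_eLpNorm_ne_top le_rfl (fun n => (hF n).1) ?_
  have h : ∀ n, eLpNorm (F n) 1 μ = ENNReal.ofReal (∫ x, ‖F n x‖ ∂μ) := fun n => by
    rw [eLpNorm_one_eq_lintegral_enorm, ofReal_integral_norm_eq_lintegral_enorm (hF n)]
  simp_rw [h]
  exact hs.tsum_ofReal_ne_top

theorem integrable_tsum_of_summable_integral_norm {X : Type*} [MeasurableSpace X]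
    {μ : Measure X} {F : ℕ → X → ℝ} (hF : ∀ n, Integrable (F n) μ)
    (hs : Summable fun n => ∫ x, ‖F n x‖ ∂μ) : Integrable (fun x => ∑' n, F n x) μ := by
  constructor
  · refine aestronglyMeasurable_of_tendsto_ae Filter.atTop
      (f := fun N x => ∑ n ∈ Finset.range N, F n x)
      (fun N => Finset.aestronglyMeasurable_fun_sum _ fun n _ => (hF n).1) ?_
    filter_upwards [ae_summable_norm_of_summable_integral_norm hF hs] with x hx
    exact hx.of_norm.hasSum.tendsto_sum_nat
  · rw [hasFiniteIntegral_iff_enorm]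
    calc ∫⁻ x, ‖∑' n, F n x‖ₑ ∂μ ≤ ∫⁻ x, ∑' n, ‖F n x‖ₑ ∂μ :=
          lintegral_mono fun x => enorm_tsum_le_tsum_enorm
      _ = ∑' n, ∫⁻ x, ‖F n x‖ₑ ∂μ := lintegral_tsum fun n => (hF n).1.enorm
      _ = ∑' n, ENNReal.ofReal (∫ x, ‖F n x‖ ∂μ) := by
          simp_rw [ofReal_integral_norm_eq_lintegral_enorm (hF _)]
      _ < ⊤ := hs.tsum_ofReal_lt_top

/-- The kernel `t₊^(α-1) E_{α,α}(-λ t^α)`, damped by the factor `exp (-c t)`. -/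
noncomputable def mittagLefflerKernel (c α lam t : ℝ) : ℝ :=
  ∑' n : ℕ, (-lam) ^ n * gammaKernel c (α * n + α) t

theorem mittagLefflerKernel_of_nonpos {c α lam t : ℝ} (ht : t ≤ 0) :
    mittagLefflerKernel c α lam t = 0 := by
  simp [mittagLefflerKernel, gammaKernel_of_nonpos ht]

theorem mittagLefflerKernel_of_pos {c α lam t : ℝ} (ht : 0 < t) :
    mittagLefflerKernel c α lam t =
      Real.exp (-(c * t)) * (t ^ (α - 1) * mittagLeffler α α (-lam * t ^ α)) := by
  rw [mittagLefflerKernel, mittagLeffler, ← tsum_mul_left, ← tsum_mul_left]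
  refine tsum_congr fun n => ?_
  have h : t ^ (α * n + α - 1) = t ^ (α - 1) * (t ^ α) ^ n := by
    rw [← Real.rpow_natCast, ← Real.rpow_mul ht.le, ← Real.rpow_add ht]
    congr 1; ring
  rw [gammaKernel_of_pos ht, h, mul_pow]
  ring

section Resolvent

variable {c α lam : ℝ}

theorem integrable_pow_mul_gammaKernel (hc : 0 < c) (hα : 0 < α) (n : ℕ) :
    Integrable fun t => (-lam) ^ n * gammaKernel c (α * n + α) t :=
  (integrable_gammaKernel hc (by positivity)).const_mul _

theorem norm_pow_mul_gammaKernel (hα : 0 < α) (hlam : 0 < lam) (n : ℕ) (t : ℝ) :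
    ‖(-lam) ^ n * gammaKernel c (α * n + α) t‖ = lam ^ n * gammaKernel c (α * n + α) t := by
  rw [norm_mul, norm_pow, norm_neg, Real.norm_of_nonneg hlam.le,
    Real.norm_of_nonneg (gammaKernel_nonneg (by positivity) t)]

theorem summable_integral_norm_pow_mul_gammaKernel (hc : 0 < c) (hα : 0 < α) (hlam : 0 < lam)
    (hcl : lam * (1 / c) ^ α < 1) :
    Summable fun n : ℕ => ∫ t, ‖(-lam) ^ n * gammaKernel c (α * n + α) t‖ := by
  have h : ∀ n : ℕ, ∫ t, ‖(-lam) ^ n * gammaKernel c (α * n + α) t‖ =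
      (lam * (1 / c) ^ α) ^ n * (1 / c) ^ α := fun n => by
    simp_rw [norm_pow_mul_gammaKernel hα hlam]
    rw [MeasureTheory.integral_const_mul, integral_gammaKernel hc (by positivity),
      Real.rpow_add (by positivity), Real.rpow_mul (by positivity), Real.rpow_natCast, mul_pow,
      mul_assoc]
  simp_rw [h]
  exact (summable_geometric_of_lt_one (by positivity) hcl).mul_right _

theorem integrable_mittagLefflerKernel (hc : 0 < c) (hα : 0 < α) (hlam : 0 < lam)
    (hcl : lam * (1 / c) ^ α < 1) : Integrable (mittagLefflerKernel c α lam) :=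
  integrable_tsum_of_summable_integral_norm (integrable_pow_mul_gammaKernel hc hα)
    (summable_integral_norm_pow_mul_gammaKernel hc hα hlam hcl)

/-- The Mittag-Leffler kernel is the resolvent of the Riemann–Liouville kernel. -/
theorem ae_integral_gammaKernel_mul_mittagLefflerKernel (hc : 0 < c) (hα : 0 < α)
    (hlam : 0 < lam) (hcl : lam * (1 / c) ^ α < 1) :
    ∀ᵐ t, lam * ∫ s, gammaKernel c α s * mittagLefflerKernel c α lam (t - s) =
      gammaKernel c α t - mittagLefflerKernel c α lam t := by
  have h1 := ae_summable_norm_of_summable_integral_norm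
    (integrable_pow_mul_gammaKernel (lam := lam) hc hα)
    (summable_integral_norm_pow_mul_gammaKernel hc hα hlam hcl)
  have h2 : ∀ᵐ t, ∀ n : ℕ, Integrable fun s =>
      gammaKernel c α s * ((-lam) ^ n * gammaKernel c (α * n + α) (t - s)) :=
    ae_all_iff.2 fun n => (integrable_gammaKernel hc hα).ae_convolution_exists
      (ContinuousLinearMap.mul ℝ ℝ) (integrable_pow_mul_gammaKernel (lam := lam) hc hα n)
  filter_upwards [h1, h2] with t ht hint
  have hconv : ∀ (x : ℝ) (n : ℕ), ∫ s, gammaKernel c α s *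
      (x ^ n * gammaKernel c (α * n + α) (t - s)) =
      x ^ n * gammaKernel c (α * (n + 1 : ℕ) + α) t := fun x n => by
    simp_rw [mul_left_comm _ (x ^ n)]
    rw [MeasureTheory.integral_const_mul,
      integral_gammaKernel_mul_gammaKernel hα (by positivity)]
    congr 2
    push_cast; ring
  have hsum : Summable fun n : ℕ => ∫ s, ‖gammaKernel c α s *
      ((-lam) ^ n * gammaKernel c (α * n + α) (t - s))‖ := by
    simp_rw [norm_mul (gammaKernel c α _), norm_pow_mul_gammaKernel hα hlam,
      Real.norm_of_nonneg (gammaKernel_nonneg hα _), hconv]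
    simp_rw [norm_pow_mul_gammaKernel hα hlam] at ht
    refine (((summable_nat_add_iff 1).2 ht).mul_left lam⁻¹).congr fun n => ?_
    rw [pow_succ]
    field_simp
  have h := integral_tsum_of_summable_integral_norm hint hsum
  simp_rw [hconv, tsum_mul_left] at h
  have hsplit := ht.of_norm.tsum_eq_zero_add
  rw [mittagLefflerKernel, hsplit]
  change _ * ∫ s, gammaKernel c α s * ∑' n : ℕ, (-lam) ^ n * gammaKernel c (α * n + α) (t - s) = _
  rw [← h, ← tsum_mul_left]
  simp only [pow_zero, one_mul, Nat.cast_zero, mul_zero, zero_add, sub_add_cancel_left]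
  rw [← tsum_neg]
  exact tsum_congr fun n => by rw [pow_succ]; ring

end Resolvent

theorem integrable_mul_comp_sub_of_bounded {f g : ℝ → ℝ} {M : ℝ} (hf : Integrable f)
    (hg : AEStronglyMeasurable g) (hM : ∀ x, ‖g x‖ ≤ M) (t : ℝ) :
    Integrable fun s => f s * g (t - s) :=
  hf.mul_bdd (c := M)
    (hg.comp_quasiMeasurePreserving (quasiMeasurePreserving_sub_left_of_right_invariant volume t))
    (.of_forall fun _ => hM _)

theorem norm_integral_mul_comp_sub_le {f g : ℝ → ℝ} {M : ℝ} (hf : Integrable f)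
    (hM : ∀ x, ‖g x‖ ≤ M) (t : ℝ) :
    ‖∫ s, f s * g (t - s)‖ ≤ (∫ s, ‖f s‖) * M := by
  rw [← MeasureTheory.integral_mul_const]
  refine norm_integral_le_of_norm_le (hf.norm.mul_const M) (.of_forall fun s => ?_)
  rw [norm_mul]
  gcongr
  exact hM _

theorem aestronglyMeasurable_integral_mul_comp_sub {f g : ℝ → ℝ} (hf : Integrable f)
    (hg : Integrable g) : AEStronglyMeasurable fun t => ∫ s, f s * g (t - s) :=
  (hf.integrable_convolution (ContinuousLinearMap.mul ℝ ℝ) hg).1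

theorem integral_mul_integral_mul_comp_sub_assoc {f g h : ℝ → ℝ} {M : ℝ} (hf : Integrable f)
    (hg : Integrable g) (hh : Integrable h) (hM : ∀ x, ‖h x‖ ≤ M) (t : ℝ) :
    ∫ x, (∫ s, f s * g (x - s)) * h (t - x) = ∫ s, f s * ∫ x, g x * h (t - s - x) :=
  convolution_assoc (ContinuousLinearMap.mul ℝ ℝ) (ContinuousLinearMap.mul ℝ ℝ)
    (ContinuousLinearMap.mul ℝ ℝ) (ContinuousLinearMap.mul ℝ ℝ) (fun x y z => mul_assoc x y z)
    (x₀ := t) hf.1 hg.1 hh.1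
    (hf.ae_convolution_exists (ContinuousLinearMap.mul ℝ ℝ) hg)
    (hg.norm.ae_convolution_exists (ContinuousLinearMap.mul ℝ ℝ) hh.norm)
    (integrable_mul_comp_sub_of_bounded hf.norm
      (aestronglyMeasurable_integral_mul_comp_sub hg.norm hh.norm)
      (norm_integral_mul_comp_sub_le (g := fun x => ‖h x‖) hg.norm
        (fun x => by simpa using hM x)) t)

/-- The convolution with the Mittag-Leffler kernel solves the fractional Volterra equation. -/
theorem integral_mittagLefflerKernel_mul_eq {c α lam M : ℝ} (hc : 0 < c) (hα : 0 < α)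
    (hlam : 0 < lam) (hcl : lam * (1 / c) ^ α < 1) {h : ℝ → ℝ} (hh : Integrable h)
    (hM : ∀ x, ‖h x‖ ≤ M) (t : ℝ) :
    ∫ x, mittagLefflerKernel c α lam x * h (t - x) = ∫ s, gammaKernel c α s *
      (h (t - s) - lam * ∫ x, mittagLefflerKernel c α lam x * h (t - s - x)) := by
  have hq := integrable_gammaKernel hc hα
  have hK := integrable_mittagLefflerKernel hc hα hlam hcl
  have hassoc := integral_mul_integral_mul_comp_sub_assoc hq hK hh hM t
  have hqh := integrable_mul_comp_sub_of_bounded hq hh.1 hM t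
  have hKh := integrable_mul_comp_sub_of_bounded hK hh.1 hM t
  have hqKh := integrable_mul_comp_sub_of_bounded hq
    (aestronglyMeasurable_integral_mul_comp_sub hK hh) (norm_integral_mul_comp_sub_le hK hM) t
  have h1 : ∫ x, (lam * ∫ s, gammaKernel c α s * mittagLefflerKernel c α lam (x - s)) *
      h (t - x) = ∫ x, (gammaKernel c α x * h (t - x) -
        mittagLefflerKernel c α lam x * h (t - x)) := by
    refine integral_congr_ae ?_
    filter_upwards [ae_integral_gammaKernel_mul_mittagLefflerKernel hc hα hlam hcl] with x hx
    rw [hx, sub_mul]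
  simp_rw [mul_assoc lam] at h1
  rw [MeasureTheory.integral_const_mul, hassoc, MeasureTheory.integral_sub hqh hKh] at h1
  simp_rw [mul_sub, mul_left_comm _ lam]
  rw [MeasureTheory.integral_sub hqh (hqKh.const_mul lam), MeasureTheory.integral_const_mul, h1]
  ring

theorem integrableOn_rpow_mul_add_one_rpow {b : ℝ} (hb : -1 < b) (hb' : 2 * b < -1) :
    IntegrableOn (fun w : ℝ => w ^ b * (w + 1) ^ b) (Set.Ioi 0) := by
  have hmeas : Measurable fun w : ℝ => w ^ b * (w + 1) ^ b := by fun_prop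
  rw [← Set.Ioc_union_Ioi_eq_Ioi zero_le_one]
  refine IntegrableOn.union ?_ ?_
  · refine Integrable.mono' ((intervalIntegrable_iff_integrableOn_Ioc_of_le zero_le_one).1
      (intervalIntegral.intervalIntegrable_rpow' hb)) hmeas.aestronglyMeasurable ?_
    filter_upwards [ae_restrict_mem measurableSet_Ioc] with w hw
    have hw0 : 0 < w := hw.1
    rw [Real.norm_of_nonneg (by positivity)]
    refine mul_le_of_le_one_right (by positivity) ?_
    exact Real.rpow_le_one_of_one_le_of_nonpos (by linarith) (by linarith)
  · refine Integrable.mono' (integrableOn_Ioi_rpow_of_lt hb' one_pos)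
      hmeas.aestronglyMeasurable ?_
    filter_upwards [ae_restrict_mem measurableSet_Ioi] with w hw
    have hw0 : 0 < w := one_pos.trans hw
    rw [Real.norm_of_nonneg (by positivity), two_mul, Real.rpow_add hw0]
    exact mul_le_mul_of_nonneg_left
      (Real.rpow_le_rpow_of_nonpos hw0 (by linarith) (by linarith)) (by positivity)

theorem integral_rpow_mul_add_one_rpow_pos {b : ℝ} (hb : -1 < b) (hb' : 2 * b < -1) :
    0 < ∫ w in Set.Ioi (0:ℝ), w ^ b * (w + 1) ^ b := by
  have hpos : ∀ w ∈ Set.Ioi (0:ℝ), 0 < w ^ b * (w + 1) ^ b := fun w (hw : 0 < w) => by positivity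
  rw [setIntegral_pos_iff_support_of_nonneg_ae
    ((ae_restrict_mem measurableSet_Ioi).mono fun w hw => (hpos w hw).le)
    (integrableOn_rpow_mul_add_one_rpow hb hb')]
  rw [Set.inter_eq_self_of_subset_right
    (show Set.Ioi (0:ℝ) ⊆ Function.support _ from fun w hw => (hpos w hw).ne')]
  simp

/-- `w^b (w+d)^b` written through the dilation of `w^b (w+1)^b` by the factor `d⁻¹`. -/
theorem rpow_mul_add_rpow_eq {b d w : ℝ} (hd : 0 < d) (hw : 0 < w) :
    w ^ b * (w + d) ^ b = d ^ (2 * b) * ((d⁻¹ * w) ^ b * (d⁻¹ * w + 1) ^ b) := by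
  have h : w + d = d * (d⁻¹ * w + 1) := by field_simp
  have hw' : w = d * (d⁻¹ * w) := by field_simp
  rw [h, Real.mul_rpow hd.le (by positivity), two_mul, Real.rpow_add hd]
  conv_lhs => rw [hw', Real.mul_rpow hd.le (by positivity)]
  field_simp

theorem integrableOn_rpow_mul_add_rpow {b d : ℝ} (hb : -1 < b) (hb' : 2 * b < -1) (hd : 0 < d) :
    IntegrableOn (fun w : ℝ => w ^ b * (w + d) ^ b) (Set.Ioi 0) := by
  have h := (integrableOn_Ioi_comp_mul_left_iff (fun w : ℝ => w ^ b * (w + 1) ^ b) 0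
    (inv_pos.2 hd)).2 (by simpa using integrableOn_rpow_mul_add_one_rpow hb hb')
  exact IntegrableOn.congr_fun (h.const_mul (d ^ (2 * b)))
    (fun w hw => (rpow_mul_add_rpow_eq hd hw).symm) measurableSet_Ioi

theorem integral_rpow_mul_add_rpow {b d : ℝ} (hd : 0 < d) :
    ∫ w in Set.Ioi (0:ℝ), w ^ b * (w + d) ^ b =
      (∫ w in Set.Ioi (0:ℝ), w ^ b * (w + 1) ^ b) * d ^ (2 * b + 1) := by
  rw [setIntegral_congr_fun measurableSet_Ioi fun w hw => rpow_mul_add_rpow_eq hd hw,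
    MeasureTheory.integral_const_mul,
    integral_comp_mul_left_Ioi (fun w : ℝ => w ^ b * (w + 1) ^ b) 0 (inv_pos.2 hd),
    mul_zero, inv_inv, smul_eq_mul, Real.rpow_add_one hd.ne']
  ring

/-- The truncated power `w₊^b`. -/
noncomputable def truncatedPower (b : ℝ) : ℝ → ℝ :=
  (Set.Ioi 0).indicator fun w => w ^ b

theorem measurable_truncatedPower (b : ℝ) : Measurable (truncatedPower b) :=
  Measurable.indicator (by fun_prop) measurableSet_Ioi

theorem truncatedPower_nonneg (b x : ℝ) : 0 ≤ truncatedPower b x :=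
  Set.indicator_nonneg (fun _ hx => Real.rpow_nonneg (le_of_lt hx) b) x

theorem truncatedPower_mul_truncatedPower_add {b d : ℝ} (hd : 0 < d) :
    (fun w => truncatedPower b w * truncatedPower b (w + d)) =
      (Set.Ioi 0).indicator fun w => w ^ b * (w + d) ^ b := by
  funext w
  by_cases hw : 0 < w
  · simp [truncatedPower, hw, add_pos hw hd]
  · simp [truncatedPower, hw]

theorem integrable_truncatedPower_mul {b t s : ℝ} (hb : -1 < b) (hb' : 2 * b < -1)
    (hts : t ≠ s) : Integrable fun z => truncatedPower b (z - t) * truncatedPower b (z - s) := by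
  wlog h : s < t generalizing t s
  · simpa only [mul_comm] using this hts.symm (lt_of_le_of_ne (not_lt.1 h) hts)
  have hd := sub_pos.2 h
  have hi := (integrable_indicator_iff measurableSet_Ioi).2
    (integrableOn_rpow_mul_add_rpow hb hb' hd)
  rw [← truncatedPower_mul_truncatedPower_add hd] at hi
  simpa using hi.comp_sub_right t

theorem integral_truncatedPower_mul {b t s : ℝ} (hts : t ≠ s) :
    ∫ z, truncatedPower b (z - t) * truncatedPower b (z - s) =
      (∫ w in Set.Ioi (0:ℝ), w ^ b * (w + 1) ^ b) * |t - s| ^ (2 * b + 1) := by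
  wlog h : s < t generalizing t s
  · rw [abs_sub_comm, ← this hts.symm (lt_of_le_of_ne (not_lt.1 h) hts)]
    simp only [mul_comm]
  have hd := sub_pos.2 h
  rw [abs_of_pos hd, ← integral_rpow_mul_add_rpow hd,
    ← MeasureTheory.integral_indicator measurableSet_Ioi,
    ← truncatedPower_mul_truncatedPower_add hd,
    ← integral_sub_right_eq_self
      (fun w => truncatedPower b w * truncatedPower b (w + (t - s))) t]
  simp

theorem ae_fst_ne_snd : ∀ᵐ p : ℝ × ℝ, p.1 ≠ p.2 := by
  have hs : MeasurableSet {p : ℝ × ℝ | p.1 = p.2} :=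
    measurableSet_eq_fun measurable_fst measurable_snd
  rw [ae_iff]
  simp only [ne_eq, not_not]
  rw [Measure.volume_eq_prod, Measure.measure_prod_null hs]
  refine .of_forall fun x => ?_
  have : Prod.mk x ⁻¹' {p : ℝ × ℝ | p.1 = p.2} = {x} := by
    ext y; simp [eq_comm]
  simp [this]

theorem gammaKernel_zero_sub_add {α : ℝ} (hα1 : α < 1) (t s : ℝ) :
    gammaKernel 0 α (t - s) + gammaKernel 0 α (s - t) = |t - s| ^ (α - 1) / Real.Gamma α := by
  rcases lt_trichotomy t s with h | rfl | h
  · rw [gammaKernel_of_nonpos (by linarith), gammaKernel_of_pos (sub_pos.2 h),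
      abs_sub_comm, abs_of_pos (sub_pos.2 h)]
    simp
  · simp [gammaKernel_of_nonpos, Real.zero_rpow (sub_ne_zero.2 hα1.ne)]
  · rw [gammaKernel_of_pos (sub_pos.2 h), gammaKernel_of_nonpos (t := s - t) (by linarith),
      abs_of_pos (sub_pos.2 h)]
    simp

theorem integrable_mul_gammaKernel_zero {α T M : ℝ} (hα : 0 < α) {g : ℝ → ℝ}
    (hg : Integrable g) (hM : ∀ x, ‖g x‖ ≤ M) (hsupp : ∀ x ∉ Set.Ioc 0 T, g x = 0) :
    Integrable fun p : ℝ × ℝ => g p.1 * (g p.2 * gammaKernel 0 α (p.1 - p.2)) := by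
  have hp : Integrable ((Set.Ioc 0 T).indicator (gammaKernel 0 α)) := by
    rw [integrable_indicator_iff measurableSet_Ioc]
    rcases le_or_gt T 0 with hT | hT
    · simp [Set.Ioc_eq_empty (not_lt.2 hT)]
    refine IntegrableOn.congr_fun (((intervalIntegrable_iff_integrableOn_Ioc_of_le hT.le).1
      (intervalIntegral.intervalIntegrable_rpow' (r := α - 1) (by linarith))).div_const
        (Real.Gamma α)) (fun x hx => ?_) measurableSet_Ioc
    simp [gammaKernel_of_pos hx.1]
  have h1 := hg.convolution_integrand (ContinuousLinearMap.mul ℝ ℝ) hp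
  have h2 := h1.bdd_mul (c := M) (hg.1.comp_fst (ν := volume)) (.of_forall fun p => hM p.1)
  refine h2.congr (.of_forall fun p => ?_)
  by_cases h1 : p.1 ∈ Set.Ioc 0 T
  · by_cases h2 : p.2 ∈ Set.Ioc 0 T
    · rcases le_or_gt (p.1 - p.2) 0 with h | h
      · simp [gammaKernel_of_nonpos h, Set.indicator_apply]
      · have : p.1 - p.2 ∈ Set.Ioc 0 T := ⟨h, by linarith [h1.2, h2.1]⟩
        simp [Set.indicator_of_mem this]
    · simp [hsupp _ h2]
  · simp [hsupp _ h1]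

/-- The Riemann–Liouville kernel of order `α ∈ (0, 1)` is of positive type. -/
theorem integral_mul_integral_gammaKernel_zero_nonneg {α T M : ℝ} (hα : 0 < α) (hα1 : α < 1)
    {g : ℝ → ℝ} (hg : Integrable g) (hM : ∀ x, ‖g x‖ ≤ M)
    (hsupp : ∀ x ∉ Set.Ioc 0 T, g x = 0) :
    0 ≤ ∫ t, g t * ∫ s, gammaKernel 0 α s * g (t - s) := by
  set J : ℝ × ℝ → ℝ := fun p => g p.1 * (g p.2 * gammaKernel 0 α (p.1 - p.2)) with hJ
  have hJint : Integrable J := integrable_mul_gammaKernel_zero hα hg hM hsupp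
  have hJswap : Integrable fun p : ℝ × ℝ => J p.swap := hJint.swap
  have hΓ := Real.Gamma_pos_of_pos hα
  have hb : -1 < α / 2 - 1 := by linarith
  have hb' : 2 * (α / 2 - 1) < -1 := by linarith
  have hexp : 2 * (α / 2 - 1) + 1 = α - 1 := by ring
  have hC := integral_rpow_mul_add_one_rpow_pos hb hb'
  have hkernel : ∀ t s : ℝ, t ≠ s →
      ∫ z, truncatedPower (α / 2 - 1) (z - t) * truncatedPower (α / 2 - 1) (z - s) = _ :=
    fun t s hts => integral_truncatedPower_mul hts
  set C := ∫ w in Set.Ioi (0:ℝ), w ^ (α / 2 - 1) * (w + 1) ^ (α / 2 - 1)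
  rw [hexp] at hkernel
  set φ := truncatedPower (α / 2 - 1) with hφ
  have hφm : Measurable φ := measurable_truncatedPower _
  have hJeq : ∫ t, g t * ∫ s, gammaKernel 0 α s * g (t - s) = ∫ p, J p := by
    rw [Measure.volume_eq_prod, integral_prod _ hJint]
    refine integral_congr_ae (.of_forall fun t => ?_)
    simp only [hJ]
    rw [MeasureTheory.integral_const_mul,
      ← integral_sub_left_eq_self (fun s => g s * gammaKernel 0 α (t - s)) volume t]
    simp [mul_comm]
  have hsum : ∀ p, J p + J p.swap = g p.1 * g p.2 * (|p.1 - p.2| ^ (α - 1) / Real.Gamma α) := by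
    intro p
    rw [← gammaKernel_zero_sub_add hα1]
    simp only [hJ, Prod.fst_swap, Prod.snd_swap]
    ring
  have htwo : ∫ p : ℝ × ℝ, g p.1 * g p.2 * (|p.1 - p.2| ^ (α - 1) / Real.Gamma α) =
      2 * ∫ p, J p := by
    simp_rw [← hsum]
    rw [MeasureTheory.integral_add hJint hJswap, two_mul]
    congr 1
    exact integral_prod_swap J
  let H : ℝ → ℝ × ℝ → ℝ := fun z p => (φ (z - p.1) * φ (z - p.2)) * (g p.1 * g p.2)
  have hHm : AEStronglyMeasurable (Function.uncurry H)
      ((volume : Measure ℝ).prod (volume : Measure (ℝ × ℝ))) := by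
    refine AEStronglyMeasurable.mul (Measurable.aestronglyMeasurable (by fun_prop)) ?_
    exact ((hg.1.comp_fst (ν := volume)).mul (hg.1.comp_snd (μ := volume))).comp_snd
  have hHint : Integrable (Function.uncurry H)
      ((volume : Measure ℝ).prod (volume : Measure (ℝ × ℝ))) := by
    rw [integrable_prod_iff' hHm]
    constructor
    · filter_upwards [ae_fst_ne_snd] with p hp
      exact (integrable_truncatedPower_mul hb hb' hp).mul_const (g p.1 * g p.2)
    · refine ((hJint.add hJswap).norm.const_mul (C * Real.Gamma α)).congr ?_
      filter_upwards [ae_fst_ne_snd] with p hp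
      simp only [Function.uncurry, H, norm_mul _ (g p.1 * g p.2), Pi.add_apply]
      rw [MeasureTheory.integral_mul_const]
      simp only [Real.norm_of_nonneg (mul_nonneg (truncatedPower_nonneg _ _)
        (truncatedPower_nonneg _ _)), hφ]
      rw [hkernel _ _ hp, hsum, norm_mul, Real.norm_of_nonneg (r := _ / _) (by positivity)]
      field_simp
  have hswap := integral_integral_swap hHint
  have hleft : 0 ≤ ∫ z, ∫ p, H z p := by
    refine MeasureTheory.integral_nonneg fun z => ?_
    have : ∫ p, H z p = (∫ t, φ (z - t) * g t) * ∫ s, φ (z - s) * g s := by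
      rw [← integral_prod_mul, ← Measure.volume_eq_prod]
      refine integral_congr_ae (.of_forall fun p => ?_)
      simp only [H]
      ring
    rw [this]
    exact mul_self_nonneg _
  have hright : ∫ p, ∫ z, H z p = C * Real.Gamma α * (2 * ∫ p, J p) := by
    rw [← htwo, ← MeasureTheory.integral_const_mul]
    refine integral_congr_ae ?_
    filter_upwards [ae_fst_ne_snd] with p hp
    simp only [H]
    rw [MeasureTheory.integral_mul_const, hkernel _ _ hp]
    field_simp
  rw [hswap, hright] at hleft
  rw [hJeq]
  by_contra! hneg
  have : C * Real.Gamma α * (2 * ∫ p, J p) < 0 :=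
    mul_neg_of_pos_of_neg (by positivity) (by linarith)
  linarith

theorem exists_pos_mul_one_div_rpow_lt_one {α lam : ℝ} (hα : 0 < α) (hlam : 0 < lam) :
    ∃ c : ℝ, 0 < c ∧ lam * (1 / c) ^ α < 1 := by
  refine ⟨(2 * lam) ^ α⁻¹, by positivity, ?_⟩
  rw [Real.div_rpow zero_le_one (by positivity), Real.rpow_inv_rpow (by positivity) hα.ne',
    Real.one_rpow]
  field_simp
  norm_num

theorem gammaKernel_eq_exp_mul (c a t : ℝ) :
    gammaKernel c a t = Real.exp (-(c * t)) * gammaKernel 0 a t := by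
  rcases le_or_gt t 0 with ht | ht
  · simp [gammaKernel_of_nonpos ht]
  · rw [gammaKernel_of_pos ht, gammaKernel_of_pos ht]
    simp only [zero_mul, neg_zero, Real.exp_zero]
    ring

theorem integral_mittagLefflerKernel_mul_indicator_of_nonpos {c α lam T t : ℝ} (f : ℝ → ℝ)
    (ht : t ≤ 0) :
    ∫ x, mittagLefflerKernel c α lam x * (Set.Ioc 0 T).indicator f (t - x) = 0 := by
  refine integral_eq_zero_of_ae (.of_forall fun x => ?_)
  rcases le_or_gt x 0 with hx | hx
  · simp [mittagLefflerKernel_of_nonpos hx]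
  · have : t - x ∉ Set.Ioc 0 T := fun h => by linarith [h.1]
    simp [Set.indicator_of_notMem this]

theorem integral_mittagLefflerKernel_mul_indicator {c α lam T t : ℝ} (f : ℝ → ℝ)
    (ht : t ∈ Set.Ioc 0 T) :
    ∫ x, mittagLefflerKernel c α lam x *
        (Set.Ioc 0 T).indicator (fun s => Real.exp (-(c * s)) * f s) (t - x) =
      Real.exp (-(c * t)) * ∫ s in (0:ℝ)..t,
        (t - s) ^ (α - 1) * mittagLeffler α α (-lam * (t - s) ^ α) * f s := by
  rw [← integral_sub_left_eq_self _ volume t, ← intervalIntegral.integral_const_mul,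
    integral_of_le ht.1.le, integral_Ioc_eq_integral_Ioo,
    ← MeasureTheory.integral_indicator measurableSet_Ioo]
  refine integral_congr_ae (.of_forall fun s => ?_)
  simp only [sub_sub_cancel]
  by_cases hs : s ∈ Set.Ioo 0 t
  · rw [Set.indicator_of_mem hs, Set.indicator_of_mem (show s ∈ Set.Ioc 0 T from
      ⟨hs.1, hs.2.le.trans ht.2⟩), mittagLefflerKernel_of_pos (sub_pos.2 hs.2),
      show -(c * t) = -(c * (t - s)) + -(c * s) by ring, Real.exp_add]
    ring
  · rw [Set.indicator_of_notMem hs]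
    rcases le_or_gt s 0 with hs0 | hs0
    · rw [Set.indicator_of_notMem fun h => hs0.not_gt h.1, mul_zero]
    · rw [mittagLefflerKernel_of_nonpos (sub_nonpos.2 (not_lt.1 fun h => hs ⟨hs0, h⟩)), zero_mul]

/-- The energy inequality behind the `L²` bound, for `u` solving the Volterra equation
`u = J^α (f - λ u)` on `(0, T]`. -/
theorem sq_mul_integral_sq_le_of_eq_integral_gammaKernel {α lam T M N : ℝ} (hα : 0 < α)
    (hα1 : α < 1) (hlam : 0 < lam) {f u : ℝ → ℝ}
    (hfm : AEStronglyMeasurable f (volume.restrict (Set.Ioc 0 T)))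
    (hum : AEStronglyMeasurable u (volume.restrict (Set.Ioc 0 T)))
    (hf : ∀ t ∈ Set.Ioc 0 T, ‖f t‖ ≤ M) (hu : ∀ t ∈ Set.Ioc 0 T, ‖u t‖ ≤ N)
    (heq : ∀ t ∈ Set.Ioc 0 T, u t = ∫ s, gammaKernel 0 α s *
      (Set.Ioc 0 T).indicator (fun s => f s - lam * u s) (t - s)) :
    lam ^ 2 * ∫ t in Set.Ioc 0 T, u t ^ 2 ≤ ∫ t in Set.Ioc 0 T, f t ^ 2 := by
  have hae : ∀ {p : ℝ → Prop}, (∀ t ∈ Set.Ioc 0 T, p t) →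
      ∀ᵐ t ∂volume.restrict (Set.Ioc 0 T), p t :=
    fun h => (ae_restrict_mem measurableSet_Ioc).mono h
  have hfi : IntegrableOn f (Set.Ioc 0 T) := .of_bound (by simp) hfm M (hae hf)
  have hui : IntegrableOn u (Set.Ioc 0 T) := .of_bound (by simp) hum N (hae hu)
  have hgi : IntegrableOn (fun s => f s - lam * u s) (Set.Ioc 0 T) := hfi.sub (hui.const_mul lam)
  have hgb : ∀ t ∈ Set.Ioc 0 T, ‖f t - lam * u t‖ ≤ M + lam * N := fun t ht => by
    refine (norm_sub_le _ _).trans (add_le_add (hf t ht) ?_)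
    rw [norm_mul, Real.norm_of_nonneg hlam.le]
    exact mul_le_mul_of_nonneg_left (hu t ht) hlam.le
  have hpos : 0 ≤ ∫ t in Set.Ioc 0 T, (f t - lam * u t) * u t := by
    have h := integral_mul_integral_gammaKernel_zero_nonneg (T := T) (M := |M + lam * N|) hα hα1
      ((integrable_indicator_iff measurableSet_Ioc).2 hgi) (fun t => ?_)
      (fun t ht => Set.indicator_of_notMem ht _)
    · rw [← MeasureTheory.integral_indicator measurableSet_Ioc]
      refine h.trans_eq (integral_congr_ae (.of_forall fun t => ?_))
      by_cases ht : t ∈ Set.Ioc 0 T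
      · simp only [Set.indicator_of_mem ht]
        rw [← heq t ht]
      · simp [Set.indicator_of_notMem ht]
    · by_cases ht : t ∈ Set.Ioc 0 T
      · rw [Set.indicator_of_mem ht]
        exact (hgb t ht).trans (le_abs_self _)
      · simp [Set.indicator_of_notMem ht]
  have hf2 : IntegrableOn (fun t => f t ^ 2) (Set.Ioc 0 T) := by
    simpa only [sq, IntegrableOn] using hfi.mul_bdd (c := M) hfm (hae hf)
  have hu2 : IntegrableOn (fun t => u t ^ 2) (Set.Ioc 0 T) := by
    simpa only [sq, IntegrableOn] using hui.mul_bdd (c := N) hum (hae hu)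
  have hgu : IntegrableOn (fun t => (f t - lam * u t) * u t) (Set.Ioc 0 T) :=
    hgi.mul_bdd (c := N) hum (hae hu)
  have hmono : ∫ t in Set.Ioc 0 T, lam ^ 2 * u t ^ 2 ≤
      ∫ t in Set.Ioc 0 T, (f t ^ 2 - 2 * lam * ((f t - lam * u t) * u t)) :=
    MeasureTheory.integral_mono (hu2.const_mul _) (hf2.sub (hgu.const_mul _)) fun t => by
      nlinarith [sq_nonneg (f t - lam * u t)]
  rw [MeasureTheory.integral_const_mul, MeasureTheory.integral_sub hf2 (hgu.const_mul _),
    MeasureTheory.integral_const_mul] at hmono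
  have : 0 ≤ 2 * lam * ∫ t in Set.Ioc 0 T, (f t - lam * u t) * u t := by positivity
  linarith

/-- The `L²(0,T)` norm of `λ · Lf`, where
`Lf(t) = ∫_0^t (t-s)^{α-1} E_{α,α}(-λ(t-s)^α) f(s) ds`,
is bounded by the `L²(0,T)` norm of `f`. -/
theorem mittagLeffler_convolution_L2_bound
    (α lam T : ℝ) (hα : α ∈ Set.Ioo (0:ℝ) 1) (hlam : 0 < lam) (hT : 0 < T)
    (f : ℝ → ℝ) (hf : ContinuousOn f (Set.Icc 0 T))
    (L : ℝ → ℝ)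
    (hL : ∀ t, L t = ∫ s in (0:ℝ)..t,
      (t - s) ^ (α - 1) * mittagLeffler α α (-lam * (t - s) ^ α) * f s) :
    lam ^ 2 * ∫ t in (0:ℝ)..T, (L t) ^ 2 ≤ ∫ t in (0:ℝ)..T, (f t) ^ 2 := by
  obtain ⟨hα0, hα1⟩ := hα
  obtain ⟨c, hc, hcl⟩ := exists_pos_mul_one_div_rpow_lt_one hα0 hlam
  obtain ⟨M, hM⟩ := isCompact_Icc.exists_bound_of_continuousOn hf
  have hM0 : 0 ≤ M := (norm_nonneg _).trans (hM 0 ⟨le_rfl, hT.le⟩)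
  have hfm : AEStronglyMeasurable f (volume.restrict (Set.Ioc 0 T)) :=
    (hf.mono Set.Ioc_subset_Icc_self).aestronglyMeasurable measurableSet_Ioc
  have hfb : ∀ t ∈ Set.Ioc 0 T, ‖f t‖ ≤ M := fun t ht => hM t (Set.Ioc_subset_Icc_self ht)
  set h : ℝ → ℝ := (Set.Ioc 0 T).indicator fun s => Real.exp (-(c * s)) * f s with hh
  have hhb : ∀ t, ‖h t‖ ≤ M := fun t => by
    by_cases ht : t ∈ Set.Ioc 0 T
    · rw [hh, Set.indicator_of_mem ht, norm_mul, Real.norm_of_nonneg (Real.exp_nonneg _)]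
      have h1 : Real.exp (-(c * t)) ≤ 1 := by
        have := mul_pos hc ht.1
        exact Real.exp_le_one_iff.2 (by linarith)
      exact (mul_le_of_le_one_left (norm_nonneg _) h1).trans (hfb t ht)
    · simpa [hh, Set.indicator_of_notMem ht] using hM0
  have hhi : Integrable h := by
    have hcont : ContinuousOn (fun s => Real.exp (-(c * s)) * f s) (Set.Icc 0 T) :=
      ContinuousOn.mul (by fun_prop) hf
    exact (integrable_indicator_iff measurableSet_Ioc).2
      (hcont.integrableOn_Icc.mono_set Set.Ioc_subset_Icc_self)
  have hK := integrable_mittagLefflerKernel hc hα0 hlam hcl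
  set U : ℝ → ℝ := fun t => ∫ x, mittagLefflerKernel c α lam x * h (t - x) with hU
  have hUm : AEStronglyMeasurable U := aestronglyMeasurable_integral_mul_comp_sub hK hhi
  have hUb := norm_integral_mul_comp_sub_le hK hhb
  have hUL : ∀ t ∈ Set.Ioc 0 T, L t = Real.exp (c * t) * U t := fun t ht => by
    rw [hL, hU]
    simp only [hh]
    rw [integral_mittagLefflerKernel_mul_indicator f ht, ← mul_assoc, ← Real.exp_add]
    simp
  have hLm : AEStronglyMeasurable L (volume.restrict (Set.Ioc 0 T)) := by
    refine AEStronglyMeasurable.congr (f := fun t => Real.exp (c * t) * U t)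
      (AEStronglyMeasurable.mul (Measurable.aestronglyMeasurable (by fun_prop)) hUm.restrict) ?_
    filter_upwards [ae_restrict_mem measurableSet_Ioc] with t ht using (hUL t ht).symm
  have hLb : ∀ t ∈ Set.Ioc 0 T, ‖L t‖ ≤
      Real.exp (c * T) * ((∫ s, ‖mittagLefflerKernel c α lam s‖) * M) := fun t ht => by
    rw [hUL t ht, norm_mul, Real.norm_of_nonneg (Real.exp_nonneg _)]
    have := ht.2
    exact mul_le_mul (Real.exp_le_exp.2 (by gcongr)) (hUb t) (norm_nonneg _) (Real.exp_nonneg _)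
  rw [integral_of_le hT.le, integral_of_le hT.le]
  refine sq_mul_integral_sq_le_of_eq_integral_gammaKernel hα0 hα1 hlam hfm hLm hfb hLb
    fun t ht => ?_
  rw [hUL t ht, hU]
  simp only
  rw [integral_mittagLefflerKernel_mul_eq hc hα0 hlam hcl hhi hhb,
    ← MeasureTheory.integral_const_mul]
  refine integral_congr_ae (.of_forall fun s => ?_)
  change _ * (_ * (h (t - s) - lam * U (t - s))) =
    _ * (Set.Ioc 0 T).indicator (fun s => f s - lam * L s) (t - s)
  rcases le_or_gt s 0 with hs | hs
  · simp [gammaKernel_of_nonpos hs]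
  by_cases hts : t - s ∈ Set.Ioc 0 T
  · have hUs : U (t - s) = Real.exp (-(c * (t - s))) * L (t - s) := by
      rw [hUL _ hts, ← mul_assoc, ← Real.exp_add]
      simp
    rw [hUs, hh, Set.indicator_of_mem hts, Set.indicator_of_mem hts, gammaKernel_eq_exp_mul c]
    have h1 : Real.exp (c * t) * Real.exp (-(c * s)) * Real.exp (-(c * (t - s))) = 1 := by
      rw [← Real.exp_add, ← Real.exp_add, Real.exp_eq_one_iff]
      ring
    linear_combination (gammaKernel 0 α s * (f (t - s) - lam * L (t - s))) * h1
  · have hts0 : t - s ≤ 0 := by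
      by_contra! hlt
      exact hts ⟨hlt, by linarith [ht.2]⟩
    have hUs : U (t - s) = 0 := integral_mittagLefflerKernel_mul_indicator_of_nonpos _ hts0
    rw [hUs, hh, Set.indicator_of_notMem hts, Set.indicator_of_notMem hts]
    simp
end

section
/- Let α ∈ (0,1), let (a_n)_{n ∈ ℕ} be a square-summable sequence of real numbers, and let (λ_n)_{n ∈ ℕ} be a sequence of nonnegative real numbers. Then lim_{t → 0⁺} ∑_{n=1}^∞ a_n² ( E_{α,1}(-λ_n t^α) - 1 )² = 0. -/
open Filter

open MeasureTheory Set Topology Interval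

theorem rpow_le_mul_Gamma_add_one {R y : ℝ} (hR : 1 ≤ R) (hy : 1 ≤ y) :
    R ^ y ≤ R * Real.exp R * Real.Gamma (y + 1) := by
  have hR0 : 0 < R := by linarith
  have hfl : 1 ≤ ⌊y⌋₊ := (Nat.one_le_floor_iff y).2 hy
  have hfle : (⌊y⌋₊ : ℝ) ≤ y := Nat.floor_le (by linarith)
  have h1 : ((⌊y⌋₊).factorial : ℝ) ≤ Real.Gamma (y + 1) := by
    rw [← Real.Gamma_nat_eq_factorial]
    have : (1 : ℝ) ≤ ⌊y⌋₊ := by exact_mod_cast hfl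
    exact Real.Gamma_strictMonoOn_Ici.monotoneOn (mem_Ici.2 (by linarith))
      (mem_Ici.2 (by linarith)) (by linarith)
  have h2 : R ^ ⌊y⌋₊ ≤ Real.exp R * (⌊y⌋₊).factorial :=
    (div_le_iff₀ (by positivity)).1 (Real.pow_div_factorial_le_exp _ hR0.le _)
  calc R ^ y ≤ R ^ ((⌊y⌋₊ : ℝ) + 1) :=
        Real.rpow_le_rpow_of_exponent_le hR (Nat.lt_floor_add_one y).le
    _ = R * R ^ ⌊y⌋₊ := by rw [Real.rpow_add_one hR0.ne', Real.rpow_natCast, mul_comm]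
    _ ≤ R * (Real.exp R * Real.Gamma (y + 1)) := by gcongr; exact h2.trans (by gcongr)
    _ = _ := by ring

theorem summable_pow_div_Gamma {α : ℝ} (hα : 0 < α) (z : ℝ) :
    Summable fun k : ℕ => z ^ k / Real.Gamma (α * k + 1) := by
  set r : ℝ := 2 * (|z| + 1) with hr
  have hr1 : 1 ≤ r := by linarith [abs_nonneg z]
  have hr0 : 0 < r := by linarith
  set R : ℝ := r ^ α⁻¹ with hRdef
  have hR : 1 ≤ R := Real.one_le_rpow hr1 (by positivity)
  refine Summable.of_norm_bounded_eventually_nat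
    (summable_geometric_two.mul_left (R * Real.exp R)) ?_
  filter_upwards [eventually_ge_atTop ⌈α⁻¹⌉₊] with k hk
  have hk' : 1 ≤ α * k := by
    have := Nat.ceil_le.1 hk
    rwa [inv_le_iff_one_le_mul₀' hα] at this
  have hpow : R ^ (α * k) = r ^ k := by
    rw [hRdef, ← Real.rpow_mul hr0.le, inv_mul_cancel_left₀ hα.ne', Real.rpow_natCast]
  have hG : 0 < Real.Gamma (α * k + 1) := Real.Gamma_pos_of_pos (by linarith)
  have key := rpow_le_mul_Gamma_add_one hR hk'
  rw [hpow] at key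
  rw [norm_div, norm_pow, Real.norm_eq_abs, Real.norm_of_nonneg hG.le, div_le_iff₀ hG]
  calc |z| ^ k ≤ (1 / 2) ^ k * r ^ k := by
        rw [← mul_pow]
        gcongr
        rw [hr]; linarith
    _ ≤ (1 / 2) ^ k * (R * Real.exp R * Real.Gamma (α * k + 1)) := by gcongr
    _ = _ := by ring

theorem differentiable_mittagLeffler_one {α : ℝ} (hα : 0 < α) :
    Differentiable ℝ (mittagLeffler α 1) := by
  set c : ℕ → ℝ := fun k => (Real.Gamma (α * k + 1))⁻¹ with hc
  have hrad : (FormalMultilinearSeries.ofScalars ℝ c).radius = ⊤ := by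
    refine FormalMultilinearSeries.radius_eq_top_of_summable_norm _ fun r => ?_
    refine (summable_pow_div_Gamma hα r).congr fun k => ?_
    have : 0 < Real.Gamma (α * k + 1) := Real.Gamma_pos_of_pos (by positivity)
    rw [FormalMultilinearSeries.ofScalars_norm, hc, Real.norm_of_nonneg (by positivity)]
    ring
  have hp := (FormalMultilinearSeries.ofScalars ℝ c).hasFPowerSeriesOnBall (by simp [hrad])
  have hsum : (FormalMultilinearSeries.ofScalars ℝ c).sum = mittagLeffler α 1 := by
    funext z
    exact (FormalMultilinearSeries.ofScalars_sum_eq c z).trans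
      (tsum_congr fun k => by simp only [hc, smul_eq_mul]; ring)
  rw [hrad, hsum] at hp
  intro z
  exact (hp.analyticAt_of_mem (by simp)).differentiableAt

theorem mittagLeffler_one_zero (α : ℝ) : mittagLeffler α 1 0 = 1 := by
  rw [mittagLeffler, tsum_eq_single 0 (fun k hk => by simp [hk])]
  simp

theorem intervalIntegrable_sub_rpow_neg {α : ℝ} (hα : α < 1) (a b t : ℝ) :
    IntervalIntegrable (fun s : ℝ => (t - s) ^ (-α)) volume a b := by
  simpa using (intervalIntegral.intervalIntegrable_rpow' (a := t - a) (b := t - b)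
    (r := -α) (by linarith)).comp_sub_left t

theorem integral_sub_rpow_neg {α : ℝ} (hα : α < 1) (t : ℝ) :
    ∫ s in (0)..t, (t - s) ^ (-α) = t ^ (1 - α) / (1 - α) := by
  rw [intervalIntegral.integral_comp_sub_left (fun x : ℝ => x ^ (-α)) t,
    integral_rpow (Or.inl (by linarith)), sub_self, Real.zero_rpow (by linarith),
    show -α + 1 = 1 - α by ring]
  simp

theorem intervalIntegrable_sub_rpow_mul {α a b t : ℝ} (hα : α < 1) (hab : a ≤ b) {w : ℝ → ℝ}
    (hw : ContinuousOn w (Icc a b)) :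
    IntervalIntegrable (fun s => (t - s) ^ (-α) * w s) volume a b :=
  (intervalIntegrable_sub_rpow_neg hα a b t).mul_continuousOn (by rwa [uIcc_of_le hab])

/-- At a zero minimum `t₀`, a nonnegative function has nonpositive Riemann-Liouville derivative. -/
theorem hasDerivAt_fractionalIntegral_nonpos {α t₀ c : ℝ} (hα0 : 0 < α) (hα : α < 1) (ht₀ : 0 < t₀)
    {w : ℝ → ℝ} (hw : ContinuousOn w (Icc 0 t₀)) (hw0 : ∀ s ∈ Icc 0 t₀, 0 ≤ w s)
    (hwt : w t₀ = 0) (hd : DifferentiableAt ℝ w t₀)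
    (hF : HasDerivAt (fun t => ∫ s in (0)..t, (t - s) ^ (-α) * w s) c t₀) : c ≤ 0 := by
  obtain ⟨C, hC⟩ := hd.isBigO_sub.bound
  rw [Metric.eventually_nhds_iff] at hC
  obtain ⟨ε, hε, hC⟩ := hC
  have hslope := (hasDerivAt_iff_tendsto_slope.1 hF).mono_left
    (nhdsWithin_mono t₀ (fun x (hx : x ∈ Iio t₀) => ne_of_lt hx))
  have hlim : Tendsto (fun t : ℝ => C * (t₀ - t) ^ (1 - α)) (𝓝[<] t₀) (𝓝 0) := by
    have hcont : ContinuousAt (fun t : ℝ => C * (t₀ - t) ^ (1 - α)) t₀ :=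
      continuousAt_const.mul
        ((continuousAt_const.sub continuousAt_id).rpow_const (Or.inr (by linarith)))
    have := hcont.tendsto
    simp only [sub_self, Real.zero_rpow (by linarith : 1 - α ≠ 0), mul_zero] at this
    exact this.mono_left nhdsWithin_le_nhds
  refine le_of_tendsto_of_tendsto hslope hlim ?_
  have hnear : ∀ᶠ t in 𝓝[<] t₀, t ∈ Ioo (max 0 (t₀ - ε)) t₀ :=
    Ioo_mem_nhdsLT (max_lt ht₀ (by linarith))
  filter_upwards [hnear] with t ht
  obtain ⟨htl, htt⟩ := ht
  have ht0 : 0 < t := (le_max_left _ _).trans_lt htl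
  have htε : t₀ - ε < t := (le_max_right _ _).trans_lt htl
  have hw₁ : ContinuousOn w (Icc 0 t) := hw.mono (Icc_subset_Icc_right htt.le)
  have i1 := intervalIntegrable_sub_rpow_mul (t := t₀) hα ht0.le hw₁
  have i2 := intervalIntegrable_sub_rpow_mul (t := t₀) hα htt.le
    (hw.mono (Icc_subset_Icc_left ht0.le))
  have i3 := intervalIntegrable_sub_rpow_mul (t := t) hα ht0.le hw₁
  have hmono : ∫ s in (0)..t, (t₀ - s) ^ (-α) * w s ≤ ∫ s in (0)..t, (t - s) ^ (-α) * w s := by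
    refine intervalIntegral.integral_mono_on_of_le_Ioo ht0.le i1 i3 fun s hs => ?_
    refine mul_le_mul_of_nonneg_right ?_ (hw0 s ⟨hs.1.le, hs.2.le.trans htt.le⟩)
    exact Real.rpow_le_rpow_of_nonpos (by linarith [hs.2]) (by linarith) (by linarith)
  have hC0 : 0 ≤ C := by
    have := (norm_nonneg _).trans
      (hC (y := t) (by rw [Real.dist_eq, abs_lt]; constructor <;> linarith))
    refine nonneg_of_mul_nonneg_left this ?_
    rw [norm_pos_iff]; linarith
  have htail : ∫ s in t..t₀, (t₀ - s) ^ (-α) * w s ≤ ∫ s in t..t₀, C * (t₀ - t) ^ (1 - α) := by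
    refine intervalIntegral.integral_mono_on_of_le_Ioo htt.le i2 (by simp) fun s hs => ?_
    have hs0 : 0 < t₀ - s := by linarith [hs.2]
    have hws := hC (y := s) (by rw [Real.dist_eq, abs_lt]; constructor <;> linarith [hs.1, hs.2])
    rw [hwt, sub_zero, Real.norm_eq_abs, Real.norm_eq_abs, abs_sub_comm, abs_of_pos hs0] at hws
    calc (t₀ - s) ^ (-α) * w s ≤ (t₀ - s) ^ (-α) * (C * (t₀ - s)) := by
          gcongr; exact (le_abs_self _).trans hws
      _ = C * (t₀ - s) ^ (1 - α) := by
          rw [show 1 - α = -α + 1 by ring, Real.rpow_add_one hs0.ne']; ring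
      _ ≤ C * (t₀ - t) ^ (1 - α) := by
          have := hs.1
          gcongr
  rw [intervalIntegral.integral_const, smul_eq_mul] at htail
  have hsplit := intervalIntegral.integral_add_adjacent_intervals i1 i2
  rw [slope_comm, slope_def_field, div_le_iff₀ (by linarith)]
  linarith

theorem integral_sub_rpow_mul_rpow {p q t : ℝ} (hp : -1 < p) (hq : -1 < q) (ht : 0 < t) :
    ∫ s in (0)..t, (t - s) ^ p * s ^ q =
      t ^ (p + q + 1) * (Real.Gamma (q + 1) * Real.Gamma (p + 1) / Real.Gamma (p + q + 2)) := by
  have h := Complex.betaIntegral_scaled ((q + 1 : ℝ) : ℂ) ((p + 1 : ℝ) : ℂ) ht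
  rw [Complex.betaIntegral_eq_Gamma_mul_div _ _ (by simpa using by linarith)
    (by simpa using by linarith), ← Complex.ofReal_add, Complex.Gamma_ofReal, Complex.Gamma_ofReal,
    Complex.Gamma_ofReal, ← Complex.ofReal_one, ← Complex.ofReal_sub, ← Complex.ofReal_sub,
    ← Complex.ofReal_sub, ← Complex.ofReal_cpow ht.le] at h
  have hI : ∫ s in (0)..t, (s : ℂ) ^ ((q + 1 - 1 : ℝ) : ℂ) * ((t : ℂ) - s) ^ ((p + 1 - 1 : ℝ) : ℂ) =
      ((∫ s in (0)..t, (t - s) ^ p * s ^ q : ℝ) : ℂ) := by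
    rw [← intervalIntegral.integral_ofReal]
    refine intervalIntegral.integral_congr fun s hs => ?_
    rw [uIcc_of_le ht.le] at hs
    simp only [add_sub_cancel_right]
    rw [← Complex.ofReal_sub, ← Complex.ofReal_cpow hs.1,
      ← Complex.ofReal_cpow (by linarith [hs.2])]
    push_cast; ring
  rw [hI] at h
  have h' : ∫ s in (0)..t, (t - s) ^ p * s ^ q = t ^ (q + 1 + (p + 1) - 1) *
      (Real.Gamma (q + 1) * Real.Gamma (p + 1) / Real.Gamma (q + 1 + (p + 1))) := by
    exact_mod_cast h
  rw [h']; congr 3 <;> ring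

/-- Termwise integration of `s ↦ E_α(-s^α)` against an integrable weight. -/
theorem hasSum_integral_mul_mittagLeffler {α t : ℝ} (hα : 0 < α) (ht : 0 ≤ t) {g : ℝ → ℝ}
    (hg : IntervalIntegrable g volume 0 t) :
    HasSum (fun k : ℕ => (-1) ^ k / Real.Gamma (α * k + 1) * ∫ s in (0)..t, g s * s ^ (α * k))
      (∫ s in (0)..t, g s * mittagLeffler α 1 (-s ^ α)) := by
  have hterm : ∀ k : ℕ, ∀ s ∈ Ι (0 : ℝ) t,
      g s * ((-s ^ α) ^ k / Real.Gamma (α * k + 1)) =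
        (-1) ^ k / Real.Gamma (α * k + 1) * (g s * s ^ (α * k)) := by
    intro k s hs
    rw [uIoc_of_le ht] at hs
    rw [Real.rpow_mul_natCast hs.1.le, neg_pow]; ring
  have key := intervalIntegral.hasSum_integral_of_dominated_convergence (μ := volume)
    (a := 0) (b := t) (F := fun (k : ℕ) s => g s * ((-s ^ α) ^ k / Real.Gamma (α * k + 1)))
    (f := fun s => g s * mittagLeffler α 1 (-s ^ α))
    (fun k s => ‖g s‖ * ((t ^ α) ^ k / Real.Gamma (α * k + 1))) ?_ ?_ ?_ ?_ ?_
  · refine key.congr_fun fun k => ?_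
    rw [← intervalIntegral.integral_const_mul]
    exact intervalIntegral.integral_congr_ae (ae_of_all _ fun s hs => (hterm k s hs).symm)
  · intro k
    refine hg.def'.aestronglyMeasurable.mul (Measurable.aestronglyMeasurable ?_)
    fun_prop
  · intro k
    refine ae_of_all _ fun s hs => ?_
    rw [uIoc_of_le ht] at hs
    have hG : 0 < Real.Gamma (α * k + 1) := Real.Gamma_pos_of_pos (by positivity)
    have hs0 := hs.1.le
    rw [norm_mul, norm_div, norm_pow, norm_neg, Real.norm_of_nonneg hG.le,
      Real.norm_of_nonneg (Real.rpow_nonneg hs0 α)]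
    gcongr
    exact hs.2
  · exact ae_of_all _ fun s _ => (summable_pow_div_Gamma hα _).mul_left _
  · simp_rw [tsum_mul_left]
    exact hg.norm.mul_const _
  · exact ae_of_all _ fun s _ => (summable_pow_div_Gamma hα _).hasSum.mul_left _

/-- The fractional relaxation equation for `s ↦ E_α(-s^α)`, in integrated form. -/
theorem fractionalIntegral_mittagLeffler {α t : ℝ} (hα0 : 0 < α) (hα : α < 1) (ht : 0 < t) :
    ∫ s in (0)..t, (t - s) ^ (-α) * mittagLeffler α 1 (-s ^ α) =
      t ^ (1 - α) / (1 - α) -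
        Real.Gamma (1 - α) * ∫ s in (0)..t, mittagLeffler α 1 (-s ^ α) := by
  have hL := hasSum_integral_mul_mittagLeffler hα0 ht.le
    (intervalIntegrable_sub_rpow_neg hα 0 t t)
  have hR := hasSum_integral_mul_mittagLeffler hα0 ht.le (g := fun _ => 1) (by simp)
  simp only [one_mul] at hR
  rw [← hasSum_nat_add_iff' 1] at hL
  have hk : ∀ k : ℕ, (-1) ^ (k + 1) / Real.Gamma (α * (k + 1 : ℕ) + 1) *
      ∫ s in (0)..t, (t - s) ^ (-α) * s ^ (α * (k + 1 : ℕ)) =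
      -Real.Gamma (1 - α) * ((-1) ^ k / Real.Gamma (α * k + 1) * ∫ s in (0)..t, s ^ (α * k)) := by
    intro k
    have hk0 : 0 ≤ α * k := by positivity
    have hk1 : 0 ≤ α * (k + 1 : ℕ) := by positivity
    have hG : 0 < Real.Gamma (α * k + 1) := Real.Gamma_pos_of_pos (by linarith)
    have hG1 : 0 < Real.Gamma (α * (k + 1 : ℕ) + 1) := Real.Gamma_pos_of_pos (by linarith)
    rw [integral_sub_rpow_mul_rpow (by linarith) (by linarith) ht,
      integral_rpow (Or.inl (by linarith)), Real.zero_rpow (by linarith),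
      show -α + α * (k + 1 : ℕ) + 1 = α * k + 1 by push_cast; ring,
      show -α + α * (k + 1 : ℕ) + 2 = α * k + 1 + 1 by push_cast; ring,
      Real.Gamma_add_one (by linarith : α * k + 1 ≠ 0), show -α + 1 = 1 - α by ring]
    have : α * k + 1 ≠ 0 := by linarith
    field_simp
    ring
  simp_rw [hk] at hL
  have := hL.unique (hR.mul_left _)
  have h0 := integral_sub_rpow_neg hα t
  simp [h0] at this
  linarith

theorem mittagLeffler_neg_rpow_mem_Icc {α t : ℝ} (hα0 : 0 < α) (hα : α < 1) (ht : 0 ≤ t) :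
    mittagLeffler α 1 (-t ^ α) ∈ Icc (0 : ℝ) 1 := by
  set u : ℝ → ℝ := fun s => mittagLeffler α 1 (-s ^ α) with hu
  have hucont : Continuous u :=
    (differentiable_mittagLeffler_one hα0).continuous.comp
      (Real.continuous_rpow_const hα0.le).neg
  have hudiff : ∀ s, 0 < s → DifferentiableAt ℝ u s := fun s hs =>
    (differentiable_mittagLeffler_one hα0 _).comp s
      (Real.differentiableAt_rpow_const_of_ne α hs.ne').neg
  have hu0 : u 0 = 1 := by simp [hu, Real.zero_rpow hα0.ne', mittagLeffler_one_zero]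
  have hGpos : 0 < Real.Gamma (1 - α) := Real.Gamma_pos_of_pos (by linarith)
  -- the fractional integral of `σ * (u - m)` and its derivative
  have hderiv : ∀ σ m t₀ : ℝ, 0 < t₀ →
      HasDerivAt (fun t => ∫ s in (0)..t, (t - s) ^ (-α) * (σ * (u s - m)))
        (σ * ((1 - m) * t₀ ^ (-α) - Real.Gamma (1 - α) * u t₀)) t₀ := by
    intro σ m t₀ ht₀
    have hpow : HasDerivAt (fun t : ℝ => t ^ (1 - α) / (1 - α)) (t₀ ^ (-α)) t₀ := by
      have hα' : 1 - α ≠ 0 := by linarith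
      have h := (Real.hasDerivAt_rpow_const (p := 1 - α) (Or.inl ht₀.ne')).div_const (1 - α)
      rwa [mul_div_cancel_left₀ _ hα', show 1 - α - 1 = -α by ring] at h
    have hint := (hucont.integral_hasStrictDerivAt 0 t₀).hasDerivAt
    refine (((hpow.const_mul (1 - m)).sub (hint.const_mul (Real.Gamma (1 - α)))).const_mul
      σ).congr_of_eventuallyEq ?_
    filter_upwards [Ioi_mem_nhds ht₀] with t ht
    have hi : ∀ w : ℝ → ℝ, Continuous w →
        IntervalIntegrable (fun s => (t - s) ^ (-α) * w s) volume 0 t := fun w hw =>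
      intervalIntegrable_sub_rpow_mul hα (le_of_lt ht) hw.continuousOn
    have h0 := integral_sub_rpow_neg hα t
    have hrew : ∀ s, (t - s) ^ (-α) * (σ * (u s - m)) =
        σ * ((t - s) ^ (-α) * u s - m * ((t - s) ^ (-α) * 1)) := fun s => by ring
    simp_rw [hrew]
    rw [intervalIntegral.integral_const_mul, intervalIntegral.integral_sub (hi _ hucont)
      ((hi _ continuous_const).const_mul m), intervalIntegral.integral_const_mul,
      fractionalIntegral_mittagLeffler hα0 hα ht]
    simp only [mul_one, h0, Pi.sub_apply]
    ring
  have hextr : ∀ σ t₀ : ℝ, 0 < t₀ → (∀ s ∈ Icc 0 t₀, 0 ≤ σ * (u s - u t₀)) →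
      σ * ((1 - u t₀) * t₀ ^ (-α) - Real.Gamma (1 - α) * u t₀) ≤ 0 := by
    intro σ t₀ ht₀ hs
    refine hasDerivAt_fractionalIntegral_nonpos hα0 hα ht₀
      (w := fun s => σ * (u s - u t₀)) ?_ hs (by simp) ?_ (hderiv σ (u t₀) t₀ ht₀)
    · exact (continuous_const.mul (hucont.sub continuous_const)).continuousOn
    · exact ((hudiff t₀ ht₀).sub_const _).const_mul σ
  have hne : (Icc 0 t).Nonempty := ⟨0, by simp [ht]⟩
  constructor
  · obtain ⟨t₀, ⟨h0, h1⟩, hmin⟩ := isCompact_Icc.exists_isMinOn hne hucont.continuousOn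
    refine le_trans ?_ (hmin (right_mem_Icc.2 ht))
    change 0 ≤ u t₀
    rcases h0.eq_or_lt with h0 | h0
    · rw [← h0, hu0]; exact zero_le_one
    have := hextr 1 t₀ h0 fun s hs => by
      have : u t₀ ≤ u s := hmin ⟨hs.1, hs.2.trans h1⟩
      linarith
    by_contra! hneg
    have hp : 0 < t₀ ^ (-α) := Real.rpow_pos_of_pos h0 _
    nlinarith
  · obtain ⟨t₀, ⟨h0, h1⟩, hmax⟩ := isCompact_Icc.exists_isMaxOn hne hucont.continuousOn
    refine (hmax (right_mem_Icc.2 ht) : u t ≤ u t₀).trans ?_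
    rcases h0.eq_or_lt with h0 | h0
    · rw [← h0, hu0]
    have := hextr (-1) t₀ h0 fun s hs => by
      have : u s ≤ u t₀ := hmax ⟨hs.1, hs.2.trans h1⟩
      linarith
    by_contra! hgt
    have hp : 0 < t₀ ^ (-α) := Real.rpow_pos_of_pos h0 _
    nlinarith

theorem mittagLeffler_neg_mem_Icc {α x : ℝ} (hα0 : 0 < α) (hα : α < 1) (hx : 0 ≤ x) :
    mittagLeffler α 1 (-x) ∈ Icc (0 : ℝ) 1 := by
  have := mittagLeffler_neg_rpow_mem_Icc hα0 hα (Real.rpow_nonneg hx α⁻¹)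
  rwa [Real.rpow_inv_rpow hx hα0.ne'] at this

/-- Strong convergence of the solution operator `S(t)` to the identity as `t → 0⁺`:
for square-summable coefficients `a_n` and nonnegative eigenvalues `λ_n`,
`∑_{n} a_n² (E_{α,1}(-λ_n t^α) - 1)² → 0` as `t → 0⁺`. -/
theorem tendsto_sum_sq_mittagLeffler_sub_one
    (α : ℝ) (hα : α ∈ Set.Ioo (0:ℝ) 1)
    (a lam : ℕ → ℝ) (ha : Summable (fun n => (a n) ^ 2))
    (hlam : ∀ n, 0 ≤ lam n) :
    Filter.Tendsto
      (fun t : ℝ => ∑' n : ℕ, (a n) ^ 2 * (mittagLeffler α 1 (-(lam n) * t ^ α) - 1) ^ 2)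
      (nhdsWithin 0 (Set.Ioi 0)) (nhds 0) := by
  obtain ⟨hα0, hα1⟩ := hα
  suffices h : Tendsto
      (fun t : ℝ => ∑' n : ℕ, (a n) ^ 2 * (mittagLeffler α 1 (-(lam n) * t ^ α) - 1) ^ 2)
      (𝓝[>] 0) (𝓝 (∑' _ : ℕ, (0 : ℝ))) by simpa using h
  refine tendsto_tsum_of_dominated_convergence ha (fun n => ?_) ?_
  · have hE : Continuous fun t : ℝ =>
        a n ^ 2 * (mittagLeffler α 1 (-(lam n) * t ^ α) - 1) ^ 2 :=
      continuous_const.mul ((((differentiable_mittagLeffler_one hα0).continuous.comp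
        (continuous_const.mul (Real.continuous_rpow_const hα0.le))).sub continuous_const).pow 2)
    have := hE.tendsto 0
    simp only [Real.zero_rpow hα0.ne', mul_zero, mittagLeffler_one_zero, sub_self,
      zero_pow two_ne_zero] at this
    exact this.mono_left nhdsWithin_le_nhds
  · filter_upwards [self_mem_nhdsWithin] with t ht n
    have hx : 0 ≤ lam n * t ^ α := mul_nonneg (hlam n) (Real.rpow_nonneg (le_of_lt ht) α)
    obtain ⟨h0, h1⟩ := mittagLeffler_neg_mem_Icc hα0 hα1 hx
    rw [← neg_mul] at h0 h1
    rw [Real.norm_of_nonneg (by positivity)]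
    refine mul_le_of_le_one_right (sq_nonneg _) ?_
    nlinarith
end

section
/- Let α ∈ (0,1), T > 0, d ≥ 1, and let Ω ⊆ ℝ^d be open. Let a_{ij} : Ω → ℝ (1 ≤ i,j ≤ d) be continuously differentiable with a_{ij} = a_{ji} and with the matrix (a_{ij}(x))_{i,j} positive semidefinite for every x ∈ Ω, and let b_j : Ω × (0,T] → ℝ (1 ≤ j ≤ d) and b₀ : Ω × (0,T] → ℝ be functions with b₀(x,t) > 0 for all (x,t). Let w : Ω × [0,T] → ℝ be such that for each t ∈ (0,T] the function w(·,t) is twice continuously differentiable on Ω, and for each x ∈ Ω the function w(x,·) is continuous on [0,T], differentiable on (0,T], and s ↦ s^{1-α} ∂_s w(x,s) extends continuously to [0,T]. Assume that for all (x,t) ∈ Ω × (0,T], d_t^α w(x,t) - ∑_{i,j=1}^d ∂_i( a_{ij} ∂_j w )(x,t) - ∑_{j=1}^d b_j(x,t) ∂_j w(x,t) + b₀(x,t) w(x,t) > 0, where d_t^α acts in the time variable. Then there exists no point (x₀,t₀) ∈ Ω × (0,T] such that w(x₀,t₀) < 0 and w(x₀,t₀) ≤ w(x,t) for all (x,t)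 ∈ Ω × [0,T]. -/
open MeasureTheory intervalIntegral Set

/-- The partial derivative `∂_i f(x)` of `f : ℝ^d → ℝ` in the `i`-th coordinate
direction. -/
noncomputable def pderiv' {d : ℕ} (i : Fin d) (f : (Fin d → ℝ) → ℝ)
    (x : Fin d → ℝ) : ℝ :=
  fderiv ℝ f x (Pi.single i 1)

/-- The pointwise Caputo fractional derivative of order `α` of `y : ℝ → ℝ` at `t`:
`d_t^α y(t) = (1/Γ(1-α)) ∫_0^t (t-s)^{-α} y'(s) ds`. -/
noncomputable def caputoDeriv (α : ℝ) (y : ℝ → ℝ) (t : ℝ) : ℝ :=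
  (1 / Real.Gamma (1 - α)) * ∫ s in (0:ℝ)..t, (t - s) ^ (-α) * deriv y s

open Filter Topology

/-- The second derivative is nonnegative at a local minimum. -/
theorem IsLocalMin.deriv_deriv_nonneg {f : ℝ → ℝ} {x : ℝ} (h : IsLocalMin f x)
    (hc : ContinuousAt f x) : 0 ≤ deriv (deriv f) x := by
  by_contra! hneg
  have hmax : IsLocalMax f x := isLocalMax_of_deriv_deriv_neg hneg h.deriv_eq_zero hc
  have hconst : f =ᶠ[𝓝 x] fun _ => f x := by
    filter_upwards [h, hmax] with y h₁ h₂ using le_antisymm h₂ h₁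
  have hzero : deriv (deriv f) x = 0 := by
    rw [hconst.deriv.deriv_eq]
    simp
  exact hneg.ne hzero

/-- The Hessian is positive semidefinite at a local minimum. -/
theorem IsLocalMin.fderiv_fderiv_nonneg {E : Type*} [NormedAddCommGroup E] [NormedSpace ℝ E]
    {u : E → ℝ} {x : E} (h : IsLocalMin u x) (hu : ContDiffAt ℝ 2 u x) (v : E) :
    0 ≤ fderiv ℝ (fderiv ℝ u) x v v := by
  let line : ℝ → E := fun s => x + s • v
  have hline : ∀ s, HasDerivAt line v s := fun s => by
    simpa [line] using ((hasDerivAt_id s).smul_const v).const_add x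
  have hline0 : line 0 = x := by simp [line]
  have htend : Tendsto line (𝓝 0) (𝓝 x) := by
    simpa [hline0] using (hline 0).continuousAt.tendsto
  have hdiff : ∀ᶠ y in 𝓝 x, DifferentiableAt ℝ u y :=
    (hu.eventually (by simp)).mono fun y hy => hy.differentiableAt (by simp)
  have hderiv : deriv (u ∘ line) =ᶠ[𝓝 0] fun s => fderiv ℝ u (line s) v := by
    filter_upwards [htend.eventually hdiff] with s hs
    exact (hs.hasFDerivAt.comp_hasDerivAt s (hline s)).deriv
  have hfderiv : DifferentiableAt ℝ (fderiv ℝ u) (line 0) := by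
    rw [hline0]
    exact (hu.fderiv_right (m := 1) (by norm_num)).differentiableAt (by simp)
  have hsecond : deriv (deriv (u ∘ line)) 0 = fderiv ℝ (fderiv ℝ u) x v v := by
    rw [hderiv.deriv_eq]
    have := (hfderiv.hasFDerivAt.comp_hasDerivAt 0 (hline 0)).clm_apply (hasDerivAt_const 0 v)
    simpa [hline0] using this.deriv
  have hmin : IsLocalMin (u ∘ line) 0 := by
    have := htend.eventually h
    simpa [IsLocalMin, IsMinFilter, hline0] using this
  have hcont : ContinuousAt (u ∘ line) 0 :=
    ContinuousAt.comp (by rw [hline0]; exact hu.continuousAt) (hline 0).continuousAt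
  exact hsecond ▸ hmin.deriv_deriv_nonneg hcont

/-- The contraction of a positive semidefinite matrix with a bilinear form whose quadratic form
is nonnegative is nonnegative. -/
theorem Matrix.PosSemidef.sum_mul_apply_nonneg {n : Type*} [Fintype n] [DecidableEq n]
    {A : Matrix n n ℝ} (hA : A.PosSemidef) (B : (n → ℝ) →L[ℝ] (n → ℝ) →L[ℝ] ℝ)
    (hB : ∀ v, 0 ≤ B v v) :
    0 ≤ ∑ i, ∑ j, A i j * B (Pi.single i 1) (Pi.single j 1) := by
  obtain ⟨m, c, rfl⟩ := Matrix.posSemidef_iff_eq_sum_vecMulVec.mp hA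
  have hexpand : ∀ v : n → ℝ,
      B v v = ∑ i, ∑ j, v i * v j * B (Pi.single i 1) (Pi.single j 1) := fun v => by
    conv_lhs => rw [pi_eq_sum_univ' v]
    simp only [map_sum, map_smul, _root_.sum_apply, _root_.smul_apply,
      smul_eq_mul, Finset.mul_sum]
    rw [Finset.sum_comm]
    exact Finset.sum_congr rfl fun i _ => Finset.sum_congr rfl fun j _ => by ring
  have hsum : ∑ i, ∑ j, (∑ k, Matrix.vecMulVec (c k) (star (c k))) i j *
      B (Pi.single i 1) (Pi.single j 1) = ∑ k, B (c k) (c k) := by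
    simp only [hexpand, Matrix.sum_apply, Matrix.vecMulVec_apply, Finset.sum_mul, star_trivial]
    rw [Finset.sum_comm_cycle, Finset.sum_comm]
  rw [hsum]
  exact Finset.sum_nonneg fun k _ => hB (c k)

/-- The second-order part of a degenerate elliptic operator in divergence form is nonnegative at
a local minimum. -/
theorem IsLocalMin.sum_pderiv_mul_pderiv_nonneg {d : ℕ} {u : (Fin d → ℝ) → ℝ} {x : Fin d → ℝ}
    (h : IsLocalMin u x) (hu : ContDiffAt ℝ 2 u x) {a : Fin d → Fin d → (Fin d → ℝ) → ℝ}
    (ha : ∀ i j, DifferentiableAt ℝ (a i j) x) (ha_symm : ∀ i j, a i j x = a j i x)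
    (ha_psd : ∀ ξ : Fin d → ℝ, 0 ≤ ∑ i : Fin d, ∑ j : Fin d, a i j x * ξ i * ξ j) :
    0 ≤ ∑ i : Fin d, ∑ j : Fin d, pderiv' i (fun y => a i j y * pderiv' j u y) x := by
  have hA : (Matrix.of fun i j => a i j x).PosSemidef := by
    refine Matrix.PosSemidef.of_dotProduct_mulVec_nonneg
      (Matrix.IsHermitian.ext fun i j => by simpa using ha_symm j i) fun ξ => ?_
    refine (ha_psd ξ).trans_eq ?_
    simp only [dotProduct, Matrix.mulVec, Finset.mul_sum, Pi.star_apply, star_trivial,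
      Matrix.of_apply]
    exact Finset.sum_congr rfl fun i _ => Finset.sum_congr rfl fun j _ => by ring
  have hfderiv : DifferentiableAt ℝ (fderiv ℝ u) x :=
    (hu.fderiv_right (m := 1) (by norm_num)).differentiableAt (by simp)
  have hterm : ∀ i j, pderiv' i (fun y => a i j y * pderiv' j u y) x =
      a i j x * fderiv ℝ (fderiv ℝ u) x (Pi.single i 1) (Pi.single j 1) := fun i j => by
    have hpartial := hfderiv.hasFDerivAt.clm_apply
      (hasFDerivAt_const (Pi.single j (1 : ℝ) : Fin d → ℝ) x)
    have := ((ha i j).hasFDerivAt.fun_mul hpartial).fderiv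
    simp only [pderiv', this]
    simp [h.fderiv_eq_zero]
  simp only [hterm]
  exact hA.sum_mul_apply_nonneg _ (h.fderiv_fderiv_nonneg hu)

/-- The product of the Caputo kernel with the increment of a function that is differentiable at
the singularity of the kernel vanishes there. -/
theorem tendsto_rpow_neg_mul_sub {α t : ℝ} (hα : α < 1) {y : ℝ → ℝ} (hy : DifferentiableAt ℝ y t) :
    Tendsto (fun s => (t - s) ^ (-α) * (y s - y t)) (𝓝[<] t) (𝓝 0) := by
  have hpow : Tendsto (fun s => (t - s) ^ (1 - α)) (𝓝[<] t) (𝓝 0) := by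
    have hc : ContinuousAt (fun s : ℝ => (t - s) ^ (1 - α)) t :=
      (continuousAt_const.sub continuousAt_id).rpow_const (Or.inr (by linarith))
    have := hc.tendsto
    rw [sub_self, Real.zero_rpow (by linarith)] at this
    exact this.mono_left nhdsWithin_le_nhds
  have hslope : Tendsto (slope y t) (𝓝[<] t) (𝓝 (deriv y t)) :=
    hy.hasDerivAt.tendsto_slope.mono_left (nhdsWithin_mono _ fun s hs => ne_of_lt hs)
  have hprod := (hpow.mul hslope).neg
  rw [zero_mul, neg_zero] at hprod
  refine hprod.congr' ?_
  filter_upwards [self_mem_nhdsWithin] with s hs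
  have hs' : 0 < t - s := sub_pos.mpr hs
  have hne : s - t ≠ 0 := by linarith
  rw [sub_eq_add_neg 1 α, Real.rpow_add hs', Real.rpow_one, slope_def_field]
  field_simp
  ring

/-- The Caputo derivative of a function is nonpositive at a time where the function attains its
minimum over the past. -/
theorem caputoDeriv_nonpos_of_forall_le {α t : ℝ} (hα : α ∈ Ioo (0 : ℝ) 1) (ht : 0 < t)
    {y : ℝ → ℝ} (hcont : ContinuousOn y (Icc 0 t)) (hdiff : ∀ s ∈ Ioc 0 t, DifferentiableAt ℝ y s)
    (hmin : ∀ s ∈ Icc 0 t, y t ≤ y s) : caputoDeriv α y t ≤ 0 := by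
  obtain ⟨hα₀, hα₁⟩ := hα
  refine mul_nonpos_of_nonneg_of_nonpos
    (one_div_nonneg.mpr (Real.Gamma_pos_of_pos (by linarith)).le) ?_
  by_cases hint : IntervalIntegrable (fun s => (t - s) ^ (-α) * deriv y s) volume 0 t
  swap
  · rw [intervalIntegral.integral_undef hint]
  have hFcont : ContinuousOn (fun s => (t - s) ^ (-α) * (y s - y t)) (Icc 0 t) := by
    intro s hs
    rcases hs.2.eq_or_lt with rfl | hst
    · rw [← continuousWithinAt_sdiff_self]
      have := (tendsto_rpow_neg_mul_sub hα₁ (hdiff s ⟨ht, le_rfl⟩)).mono_left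
        (nhdsWithin_mono s (s := Icc 0 s \ {s}) fun r hr => lt_of_le_of_ne hr.1.2 hr.2)
      simpa [ContinuousWithinAt] using this
    · exact ((continuousAt_const.sub continuousAt_id).rpow_const
        (Or.inl (sub_pos.mpr hst).ne')).continuousWithinAt.mul
        ((hcont s hs).sub continuousWithinAt_const)
  have hFderiv : ∀ s ∈ Ioo 0 t, HasDerivAt (fun s => (t - s) ^ (-α) * (y s - y t))
      (α * (t - s) ^ (-α - 1) * (y s - y t) + (t - s) ^ (-α) * deriv y s) s := fun s hs => by
    have hk := ((hasDerivAt_id s).const_sub t).rpow_const (p := -α)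
      (Or.inl (sub_pos.mpr hs.2).ne')
    exact (hk.fun_mul ((hdiff s ⟨hs.1, hs.2.le⟩).hasDerivAt.sub_const (y t))).congr_deriv (by simp)
  have hle := integral_le_sub_of_hasDeriv_right_of_le ht.le hFcont
    (fun s hs => (hFderiv s hs).hasDerivWithinAt)
    ((intervalIntegrable_iff_integrableOn_Icc_of_le ht.le).mp hint) fun s hs => by
      have hy := sub_nonneg.mpr (hmin s ⟨hs.1.le, hs.2.le⟩)
      have hk := Real.rpow_nonneg (sub_pos.mpr hs.2).le (-α - 1)
      exact le_add_of_nonneg_left (mul_nonneg (mul_nonneg hα₀.le hk) hy)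
  have hF0 : 0 ≤ (t - 0) ^ (-α) * (y 0 - y t) :=
    mul_nonneg (Real.rpow_nonneg (by linarith) _) (sub_nonneg.mpr (hmin 0 ⟨le_rfl, ht.le⟩))
  refine hle.trans ?_
  simpa using hF0

/-- Interior negative-minimum exclusion for the time-fractional diffusion
inequality: if `d_t^α w - ∑ ∂_i(a_{ij} ∂_j w) - ∑ b_j ∂_j w + b₀ w > 0` on
`Ω × (0,T]` with `(a_{ij})` symmetric positive semidefinite and `b₀ > 0`,
then `w` cannot attain a negative minimum over `Ω × [0,T]` at a point of
`Ω × (0,T]`. -/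
theorem no_negative_interior_minimum
    (α T : ℝ) (hα : α ∈ Set.Ioo (0:ℝ) 1) (hT : 0 < T)
    (d : ℕ) (hd : 1 ≤ d) (Ω : Set (Fin d → ℝ)) (hΩ : IsOpen Ω)
    (a : Fin d → Fin d → (Fin d → ℝ) → ℝ)
    (ha_smooth : ∀ i j, ContDiffOn ℝ 1 (a i j) Ω)
    (ha_symm : ∀ i j, ∀ x ∈ Ω, a i j x = a j i x)
    (ha_psd : ∀ x ∈ Ω, ∀ ξ : Fin d → ℝ,
      0 ≤ ∑ i : Fin d, ∑ j : Fin d, a i j x * ξ i * ξ j)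
    (b : Fin d → (Fin d → ℝ) → ℝ → ℝ)
    (b₀ : (Fin d → ℝ) → ℝ → ℝ)
    (hb₀ : ∀ x ∈ Ω, ∀ t ∈ Set.Ioc (0:ℝ) T, 0 < b₀ x t)
    (w : (Fin d → ℝ) → ℝ → ℝ)
    (hw_space : ∀ t ∈ Set.Ioc (0:ℝ) T, ContDiffOn ℝ 2 (fun x => w x t) Ω)
    (hw_time_cont : ∀ x ∈ Ω, ContinuousOn (w x) (Set.Icc 0 T))
    (hw_time_diff : ∀ x ∈ Ω, ∀ s ∈ Set.Ioc (0:ℝ) T, DifferentiableAt ℝ (w x) s)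
    (hw_time_ext : ∀ x ∈ Ω, ∃ g : ℝ → ℝ, ContinuousOn g (Set.Icc 0 T) ∧
      ∀ s ∈ Set.Ioc (0:ℝ) T, g s = s ^ (1 - α) * deriv (w x) s)
    (hineq : ∀ x ∈ Ω, ∀ t ∈ Set.Ioc (0:ℝ) T,
      0 < caputoDeriv α (w x) t
          - (∑ i : Fin d, ∑ j : Fin d,
              pderiv' i (fun y => a i j y * pderiv' j (fun z => w z t) y) x)
          - (∑ j : Fin d, b j x t * pderiv' j (fun z => w z t) x)
          + b₀ x t * w x t) :
    ¬ ∃ x₀ ∈ Ω, ∃ t₀ ∈ Set.Ioc (0:ℝ) T,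
        w x₀ t₀ < 0 ∧ ∀ x ∈ Ω, ∀ t ∈ Set.Icc (0:ℝ) T, w x₀ t₀ ≤ w x t := by
  rintro ⟨x₀, hx₀, t₀, ht₀, hneg, hmin⟩
  have hnhds : Ω ∈ 𝓝 x₀ := hΩ.mem_nhds hx₀
  have hlocal : IsLocalMin (fun z => w z t₀) x₀ := by
    filter_upwards [hnhds] with x hx using hmin x hx t₀ (Ioc_subset_Icc_self ht₀)
  have hcaputo : caputoDeriv α (w x₀) t₀ ≤ 0 :=
    caputoDeriv_nonpos_of_forall_le hα ht₀.1
      ((hw_time_cont x₀ hx₀).mono (Icc_subset_Icc_right ht₀.2))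
      (fun s hs => hw_time_diff x₀ hx₀ s ⟨hs.1, hs.2.trans ht₀.2⟩)
      (fun s hs => hmin x₀ hx₀ s ⟨hs.1, hs.2.trans ht₀.2⟩)
  have hdiffusion := hlocal.sum_pderiv_mul_pderiv_nonneg ((hw_space t₀ ht₀).contDiffAt hnhds)
    (fun i j => ((ha_smooth i j).contDiffAt hnhds).differentiableAt (by simp))
    (fun i j => ha_symm i j x₀ hx₀) (ha_psd x₀ hx₀)
  have hdrift : ∑ j : Fin d, b j x₀ t₀ * pderiv' j (fun z => w z t₀) x₀ = 0 := by
    simp [pderiv', hlocal.fderiv_eq_zero]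
  have hreaction := mul_neg_of_pos_of_neg (hb₀ x₀ hx₀ t₀ ht₀) hneg
  linarith [hineq x₀ hx₀ t₀ ht₀]
end
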